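/- Let u_1, u_2, … be i.i.d. real random variables whose common law has density g and satisfies Λ(s) := log ∫_ℝ e^{su} g(u) du < ∞ for every s ∈ ℝ. Write m = E[u_1], S_τ = u_1 + ⋯ + u_τ, Λ*(q) = sup_{s∈ℝ}(sq − Λ(s)), Λ'(∞) = lim_{s→∞} Λ'(s), and for q ∈ [m, Λ'(∞)) let η(q) ≥ 0 be the unique solution of Λ'(η(q)) = q, equivalently η(q) = (Λ*)'(q), i.e., q = (∫ u e^{η u} g(u) du)/(∫ e^{η y} g(y) dy). Then for every K with m < K < Λ'(∞), every β ∈ (0, 1/2), and every ε > 0, there exists τ_0 such that for all integers τ ≥ τ_0, all q ∈ [m, K], and all x ∈ ℝ with |x| ≤ τ^β: | P(S_τ ≥ qτ + x) / P(S_τ ≥ qτ) − e^{−η(q) x} | ≤ ε · e^{−η(q) x}. -/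

import Mathlib

open MeasureTheory Filter Set
open scoped ENNReal

/-- The law of the sum `S_τ = u_1 + ⋯ + u_τ` of `τ` i.i.d. random variables with common
density `g`: the pushforward of the `τ`-fold product of `g(u) du` under summation. -/
noncomputable def sumLaw (g : ℝ → ℝ) (τ : ℕ) : Measure ℝ :=
  Measure.map (fun ω : Fin τ → ℝ => ∑ i, ω i)
    (Measure.pi fun _ : Fin τ => volume.withDensity fun t => ENNReal.ofReal (g t))

/-- The triangle function of half-width `R`. -/
noncomputable def tri (R ξ : ℝ) : ℝ := max 0 (1 - |ξ| / R)

/-- The Fejér kernel, as the Fourier transform of the triangle function. -/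
noncomputable def fejer (R y : ℝ) : ℝ := ∫ ξ, tri R ξ * Real.cos (ξ * y)

lemma tri_nonneg (R ξ : ℝ) : 0 ≤ tri R ξ := le_max_left _ _

lemma tri_le_one {R : ℝ} (hR : 0 < R) (ξ : ℝ) : tri R ξ ≤ 1 :=
  max_le zero_le_one (sub_le_self _ (by positivity))

lemma one_sub_tri_le (R ξ : ℝ) : 1 - tri R ξ ≤ |ξ| / R := by
  have := le_max_right 0 (1 - |ξ| / R)
  unfold tri
  linarith

lemma tri_eq_zero {R ξ : ℝ} (hR : 0 < R) (h : R ≤ |ξ|) : tri R ξ = 0 := by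
  apply max_eq_left
  have : 1 ≤ |ξ| / R := by rwa [le_div_iff₀ hR, one_mul]
  linarith

lemma continuous_tri (R : ℝ) : Continuous (tri R) := by
  unfold tri
  fun_prop

lemma integrable_tri {R : ℝ} (hR : 0 < R) : Integrable (tri R) := by
  apply (continuous_tri R).integrable_of_hasCompactSupport
  apply HasCompactSupport.of_support_subset_isCompact (isCompact_Icc (a := -R) (b := R))
  intro ξ hξ
  by_contra h
  rw [mem_Icc, ← abs_le, not_le] at h
  exact hξ (tri_eq_zero hR h.le)

lemma integrable_tri_mul_cos {R : ℝ} (hR : 0 < R) (y : ℝ) :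
    Integrable fun ξ => tri R ξ * Real.cos (ξ * y) := by
  refine (integrable_tri hR).mono' ?_ (Eventually.of_forall fun ξ => ?_)
  · exact ((continuous_tri R).mul (by fun_prop)).aestronglyMeasurable
  · rw [Real.norm_eq_abs, abs_mul, abs_of_nonneg (tri_nonneg R ξ)]
    exact mul_le_of_le_one_right (tri_nonneg R ξ) (Real.abs_cos_le_one _)

lemma fejer_eq {R y : ℝ} (hR : 0 < R) (hy : y ≠ 0) :
    fejer R y = 2 * (1 - Real.cos (R * y)) / (R * y ^ 2) := by
  have h1 : fejer R y = ∫ ξ, (fun t => max 0 (1 - t / R) * Real.cos (t * y)) |ξ| := by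
    unfold fejer tri
    congr 1
    ext ξ
    rcases abs_cases ξ with h | h <;> simp [h.1]
  rw [h1, integral_comp_abs (f := fun t => max 0 (1 - t / R) * Real.cos (t * y))]
  have h2 : ∫ t in Ioi (0 : ℝ), max 0 (1 - t / R) * Real.cos (t * y)
      = ∫ t in Ioc (0 : ℝ) R, (1 - t / R) * Real.cos (t * y) := by
    rw [← integral_indicator measurableSet_Ioi, ← integral_indicator measurableSet_Ioc]
    congr 1
    ext t
    simp only [indicator, mem_Ioi, mem_Ioc]
    by_cases h0 : 0 < t <;> by_cases h3 : t ≤ R <;> simp only [h0, h3, if_true, if_false,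
      and_true, and_false]
    · rw [max_eq_right]
      have : t / R ≤ 1 := by rwa [div_le_one hR]
      linarith
    · rw [max_eq_left, zero_mul]
      have : 1 ≤ t / R := by rw [le_div_iff₀ hR]; linarith
      linarith
  rw [h2, ← intervalIntegral.integral_of_le hR.le]
  have h3 : ∀ t ∈ uIcc 0 R, HasDerivAt
      (fun t => (1 - t / R) * Real.sin (t * y) / y - Real.cos (t * y) / (R * y ^ 2))
      ((1 - t / R) * Real.cos (t * y)) t := by
    intro t _
    have hs : HasDerivAt (fun t => Real.sin (t * y)) (Real.cos (t * y) * y) t := by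
      simpa using ((hasDerivAt_id t).mul_const y).sin
    have hc : HasDerivAt (fun t => Real.cos (t * y)) (-Real.sin (t * y) * y) t := by
      simpa using ((hasDerivAt_id t).mul_const y).cos
    have hl : HasDerivAt (fun t : ℝ => 1 - t / R) (-(1 / R)) t := by
      simpa using ((hasDerivAt_id t).div_const R).const_sub 1
    convert! ((hl.mul hs).div_const y).sub (hc.div_const (R * y ^ 2)) using 1
    field_simp
    ring
  rw [intervalIntegral.integral_eq_sub_of_hasDerivAt h3
    (Continuous.intervalIntegrable (by fun_prop) _ _)]
  have : (1 - R / R) = 0 := by rw [div_self hR.ne']; ring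
  simp only [this, zero_mul, zero_div, Real.sin_zero, Real.cos_zero, mul_zero]
  field_simp
  ring

lemma fejer_neg (R y : ℝ) : fejer R (-y) = fejer R y := by
  simp [fejer]

lemma fejer_le {R : ℝ} (hR : 0 < R) (y : ℝ) : fejer R y ≤ ∫ ξ, tri R ξ := by
  refine integral_mono (integrable_tri_mul_cos hR y) (integrable_tri hR) fun ξ => ?_
  exact mul_le_of_le_one_right (tri_nonneg R ξ) (Real.cos_le_one _)

lemma fejer_nonneg {R : ℝ} (hR : 0 < R) (y : ℝ) : 0 ≤ fejer R y := by
  by_cases hy : y = 0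
  · exact integral_nonneg fun ξ => by simpa [hy] using tri_nonneg R ξ
  · rw [fejer_eq hR hy]
    have := Real.cos_le_one (R * y)
    have : 0 ≤ 1 - Real.cos (R * y) := by linarith
    positivity

lemma continuous_fejer {R : ℝ} (hR : 0 < R) : Continuous (fejer R) := by
  refine continuous_of_dominated (bound := tri R) (fun y => ?_) (fun y => ?_) (integrable_tri hR) ?_
  · exact ((continuous_tri R).mul (by fun_prop)).aestronglyMeasurable
  · refine Eventually.of_forall fun ξ => ?_
    rw [Real.norm_eq_abs, abs_mul, abs_of_nonneg (tri_nonneg R ξ)]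
    exact mul_le_of_le_one_right (tri_nonneg R ξ) (Real.abs_cos_le_one _)
  · exact Eventually.of_forall fun ξ => by fun_prop

lemma fejer_eq_scale {R : ℝ} (hR : 0 < R) (y : ℝ) : fejer R y = R * fejer 1 (R * y) := by
  by_cases hy : y = 0
  · have := Measure.integral_comp_mul_left (fun ξ => tri 1 ξ) R⁻¹
    subst hy
    simp only [fejer, mul_zero, Real.cos_zero, mul_one]
    rw [inv_inv, abs_of_pos hR, smul_eq_mul] at this
    rw [← this]
    congr 1
    ext ξ
    unfold tri
    rw [abs_mul, abs_inv, abs_of_pos hR]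
    congr 2
    field_simp
  · rw [fejer_eq hR hy, fejer_eq one_pos (mul_ne_zero hR.ne' hy)]
    field_simp

lemma integrable_fejer_one : Integrable (fejer 1) := by
  have h := (integrable_inv_one_add_sq).const_mul (4 + 2 * ∫ ξ, tri 1 ξ)
  refine h.mono' (continuous_fejer one_pos).aestronglyMeasurable (Eventually.of_forall fun y => ?_)
  rw [Real.norm_eq_abs, abs_of_nonneg (fejer_nonneg one_pos y), ← div_eq_mul_inv,
    le_div_iff₀ (by positivity)]
  have h1 : fejer 1 y * y ^ 2 ≤ 4 := by
    by_cases hy : y = 0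
    · simp [hy]
    · rw [fejer_eq one_pos hy]
      have := Real.neg_one_le_cos (1 * y)
      field_simp
      simp at this
      linarith
  have h2 := fejer_le one_pos y
  have h3 := fejer_nonneg one_pos y
  nlinarith

lemma integrable_fejer {R : ℝ} (hR : 0 < R) : Integrable (fejer R) := by
  have := (integrable_fejer_one.comp_mul_left' hR.ne').const_mul R
  exact this.congr (Eventually.of_forall fun y => (fejer_eq_scale hR y).symm)

lemma integral_fejer {R : ℝ} (hR : 0 < R) : ∫ y, fejer R y = ∫ y, fejer 1 y := by
  simp_rw [fejer_eq_scale hR]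
  rw [integral_const_mul, Measure.integral_comp_mul_left, abs_of_pos (inv_pos.2 hR), smul_eq_mul,
    mul_inv_cancel_left₀ hR.ne']

lemma integral_fejer_pos : 0 < ∫ y, fejer 1 y := by
  rw [integral_pos_iff_support_of_nonneg (fejer_nonneg one_pos) integrable_fejer_one]
  apply IsOpen.measure_pos _ ((continuous_fejer one_pos).isOpen_support)
  refine ⟨1, ?_⟩
  rw [Function.mem_support, fejer_eq one_pos one_ne_zero]
  have : Real.cos 1 < 1 := by
    have h := Real.strictAntiOn_cos (a := 0) (b := 1) ⟨le_rfl, Real.pi_pos.le⟩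
      ⟨zero_le_one, by linarith [Real.pi_gt_three]⟩ one_pos
    simpa using h
  norm_num
  linarith

/-- The mass of the Fejér kernel concentrates near the origin as the bandwidth grows. -/
lemma exists_fejer_concentrated {a κ : ℝ} (ha : 0 < a) (hκ : 0 < κ) :
    ∃ R : ℝ, 0 < R ∧ (∫ y, fejer 1 y) - κ ≤ ∫ y in Icc (-a) a, fejer R y := by
  have h := intervalIntegral_tendsto_integral (l := atTop) (a := fun R : ℝ => R * (-a))
    (b := fun R : ℝ => R * a) integrable_fejer_one
    (tendsto_id.atTop_mul_const_of_neg (by linarith)) (tendsto_id.atTop_mul_const ha)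
  obtain ⟨R, hR, h0⟩ := ((h.eventually (lt_mem_nhds (sub_lt_self _ hκ))).and
    (eventually_gt_atTop 0)).exists
  refine ⟨R, h0, ?_⟩
  rw [integral_Icc_eq_integral_Ioc, ← intervalIntegral.integral_of_le (by linarith)]
  simp_rw [fejer_eq_scale h0]
  rw [intervalIntegral.integral_const_mul, intervalIntegral.integral_comp_mul_left _ h0.ne',
    smul_eq_mul, mul_inv_cancel_left₀ h0.ne']
  exact hR.le

/-- The law `μ` smoothed by the Fejér kernel. -/
noncomputable def smoothed (R : ℝ) (μ : Measure ℝ) (y : ℝ) : ℝ := ∫ t, fejer R (y - t) ∂μ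

lemma smoothed_nonneg {R : ℝ} (hR : 0 < R) (μ : Measure ℝ) (y : ℝ) : 0 ≤ smoothed R μ y :=
  integral_nonneg fun _ => fejer_nonneg hR _

lemma re_exp_mul_charFun (μ : Measure ℝ) [IsProbabilityMeasure μ] (y ξ : ℝ) :
    (Complex.exp (-(ξ * y * Complex.I)) * charFun μ ξ).re = ∫ t, Real.cos (ξ * (y - t)) ∂μ := by
  rw [charFun_apply_real, ← integral_const_mul]
  have h : ∀ t : ℝ, Complex.exp (-(ξ * y * Complex.I)) * Complex.exp (ξ * t * Complex.I)
      = Complex.exp ((ξ * (t - y) : ℝ) * Complex.I) := by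
    intro t
    rw [← Complex.exp_add]
    congr 1
    push_cast
    ring
  simp_rw [h]
  have hint : Integrable (fun t : ℝ => Complex.exp ((ξ * (t - y) : ℝ) * Complex.I)) μ := by
    refine (integrable_const (1 : ℝ)).mono' (by fun_prop) (Eventually.of_forall fun t => ?_)
    rw [Complex.norm_exp_ofReal_mul_I]
  have := Complex.reCLM.integral_comp_comm hint
  simp only [Complex.reCLM_apply] at this
  rw [← this]
  congr 1
  ext t
  rw [Complex.exp_ofReal_mul_I_re, ← Real.cos_neg]
  congr 1
  ring

lemma smoothed_eq {R : ℝ} (hR : 0 < R) (μ : Measure ℝ) [IsProbabilityMeasure μ] (y : ℝ) :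
    smoothed R μ y
      = ∫ ξ, tri R ξ * (Complex.exp (-(ξ * y * Complex.I)) * charFun μ ξ).re := by
  unfold smoothed fejer
  rw [integral_integral_swap]
  · congr 1
    ext ξ
    rw [re_exp_mul_charFun, integral_const_mul]
  · refine ((integrable_tri hR).comp_snd μ).mono' ?_ (Eventually.of_forall fun z => ?_)
    · have : Continuous (Function.uncurry fun (t ξ : ℝ) => tri R ξ * Real.cos (ξ * (y - t))) := by
        have := continuous_tri R
        unfold Function.uncurry
        fun_prop
      exact this.aestronglyMeasurable
    · simp only [Function.uncurry]
      rw [Real.norm_eq_abs, abs_mul, abs_of_nonneg (tri_nonneg R _)]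
      exact mul_le_of_le_one_right (tri_nonneg R _) (Real.abs_cos_le_one _)

lemma integral_gaussian_mul_cos {b : ℝ} (hb : 0 < b) (y : ℝ) :
    ∫ ξ : ℝ, Real.exp (-b * ξ ^ 2) * Real.cos (ξ * y)
      = √(Real.pi / b) * Real.exp (-y ^ 2 / (4 * b)) := by
  have h := fourierIntegral_gaussian (b := (b : ℂ)) (by simpa using hb) (y : ℂ)
  have h1 : ∀ x : ℝ, Complex.exp (Complex.I * y * x) * Complex.exp (-(b : ℂ) * (x : ℂ) ^ 2)
      = (Real.exp (-b * x ^ 2) : ℂ) * Complex.exp ((x * y : ℝ) * Complex.I) := by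
    intro x
    rw [mul_comm]
    push_cast
    congr 2
    ring
  simp_rw [h1] at h
  have hint : Integrable (fun x : ℝ =>
      (Real.exp (-b * x ^ 2) : ℂ) * Complex.exp ((x * y : ℝ) * Complex.I)) := by
    refine (integrable_exp_neg_mul_sq hb).mono' (by fun_prop) (Eventually.of_forall fun x => ?_)
    rw [norm_mul, Complex.norm_exp_ofReal_mul_I, mul_one, Complex.norm_real, Real.norm_eq_abs,
      abs_of_pos (Real.exp_pos _)]
  have h2 := Complex.reCLM.integral_comp_comm hint
  rw [h] at h2
  simp only [Complex.reCLM_apply, Complex.re_ofReal_mul, Complex.exp_ofReal_mul_I_re] at h2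
  rw [h2]
  have h3 : ((Real.pi : ℂ) / b) ^ (1 / 2 : ℂ) = (√(Real.pi / b) : ℝ) := by
    rw [Real.sqrt_eq_rpow, Complex.ofReal_cpow (by positivity)]
    push_cast
    rfl
  have h4 : Complex.exp (-(y : ℂ) ^ 2 / (4 * b)) = (Real.exp (-y ^ 2 / (4 * b)) : ℝ) := by
    push_cast
    rfl
  rw [h3, h4, ← Complex.ofReal_mul, Complex.ofReal_re]

lemma norm_pow_succ_sub_pow_succ_le {a b : ℂ} {ρ : ℝ} (ha : ‖a‖ ≤ ρ) (hb : ‖b‖ ≤ ρ) (n : ℕ) :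
    ‖a ^ (n + 1) - b ^ (n + 1)‖ ≤ (n + 1) * ρ ^ n * ‖a - b‖ := by
  have hρ : 0 ≤ ρ := (norm_nonneg a).trans ha
  induction n with
  | zero => simp
  | succ n ih =>
    have h : a ^ (n + 1 + 1) - b ^ (n + 1 + 1)
        = a ^ (n + 1) * (a - b) + (a ^ (n + 1) - b ^ (n + 1)) * b := by ring
    rw [h]
    refine (norm_add_le _ _).trans ?_
    rw [norm_mul, norm_mul, norm_pow]
    have h1 : ‖a‖ ^ (n + 1) * ‖a - b‖ ≤ ρ ^ (n + 1) * ‖a - b‖ := by gcongr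
    have h2 : ‖a ^ (n + 1) - b ^ (n + 1)‖ * ‖b‖ ≤ ((n + 1) * ρ ^ n * ‖a - b‖) * ρ := by gcongr
    refine (add_le_add h1 h2).trans (le_of_eq ?_)
    push_cast
    ring

/-- Pointwise comparison of a triangle-damped `n`-th power with a Gaussian. -/
lemma abs_tri_mul_sub_gaussian_le {R c D v ξ y : ℝ} {n : ℕ} {z : ℂ} (hR : 0 < R) (hc : 0 < c)
    (hD : 0 ≤ D) (hv : 2 * c ≤ v) (hn : 2 ≤ n)
    (hz : |ξ| ≤ R → ‖z‖ ≤ Real.exp (-(c * ξ ^ 2)) ∧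
      ‖z - (Real.exp (-(v * ξ ^ 2 / 2)) : ℝ)‖ ≤ D * |ξ| ^ 3) :
    |tri R ξ * (Complex.exp (-(ξ * y * Complex.I)) * z ^ n).re
        - Real.exp (-(n * v / 2) * ξ ^ 2) * Real.cos (ξ * y)|
      ≤ (n * D * |ξ| ^ 3 + |ξ| / R) * Real.exp (-(c * n / 2 * ξ ^ 2)) := by
  set γ : ℝ := Real.exp (-(v * ξ ^ 2 / 2)) with hγ
  have hn' : (2 : ℝ) ≤ n := by exact_mod_cast hn
  have hγn : Real.exp (-(n * v / 2) * ξ ^ 2) = γ ^ n := by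
    rw [hγ, ← Real.exp_nat_mul]
    congr 1
    ring
  have hγ_le : γ ≤ Real.exp (-(c * ξ ^ 2)) := Real.exp_le_exp.2 (by nlinarith [sq_nonneg ξ])
  have hpow_le : γ ^ n ≤ Real.exp (-(c * n / 2 * ξ ^ 2)) := by
    rw [← hγn]
    apply Real.exp_le_exp.2
    have : 0 ≤ (n : ℝ) * ξ ^ 2 := by positivity
    nlinarith
  have hre : Real.exp (-(n * v / 2) * ξ ^ 2) * Real.cos (ξ * y)
      = (Complex.exp (-(ξ * y * Complex.I)) * ((γ : ℂ)) ^ n).re := by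
    have : Complex.exp (-(ξ * y * Complex.I)) = Complex.exp ((-(ξ * y) : ℝ) * Complex.I) := by
      congr 1
      push_cast
      ring
    rw [this, hγn, ← Complex.ofReal_pow, Complex.re_mul_ofReal, Complex.exp_ofReal_mul_I_re,
      Real.cos_neg, mul_comm]
  have hre_abs : ∀ w : ℂ, |(Complex.exp (-(ξ * y * Complex.I)) * w).re| ≤ ‖w‖ := by
    intro w
    refine (Complex.abs_re_le_norm _).trans ?_
    have : -((ξ : ℂ) * y * Complex.I) = ((-(ξ * y) : ℝ) : ℂ) * Complex.I := by
      push_cast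
      ring
    rw [norm_mul, this, Complex.norm_exp_ofReal_mul_I, one_mul]
  have hγnorm : ‖((γ : ℂ)) ^ n‖ = γ ^ n := by
    rw [norm_pow, Complex.norm_real, Real.norm_eq_abs, abs_of_pos (Real.exp_pos _)]
  have hsplit : tri R ξ * (Complex.exp (-(ξ * y * Complex.I)) * z ^ n).re
        - Real.exp (-(n * v / 2) * ξ ^ 2) * Real.cos (ξ * y)
      = tri R ξ * (Complex.exp (-(ξ * y * Complex.I)) * (z ^ n - (γ : ℂ) ^ n)).re
        - (1 - tri R ξ) * (Complex.exp (-(ξ * y * Complex.I)) * ((γ : ℂ)) ^ n).re := by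
    rw [hre, mul_sub, Complex.sub_re]
    ring
  rw [hsplit]
  have h1 : |tri R ξ * (Complex.exp (-(ξ * y * Complex.I)) * (z ^ n - (γ : ℂ) ^ n)).re|
      ≤ n * D * |ξ| ^ 3 * Real.exp (-(c * n / 2 * ξ ^ 2)) := by
    rw [abs_mul, abs_of_nonneg (tri_nonneg R ξ)]
    by_cases hξ : |ξ| ≤ R
    · obtain ⟨hz1, hz2⟩ := hz hξ
      obtain ⟨k, rfl⟩ : ∃ k, n = k + 1 := ⟨n - 1, by omega⟩
      have hb := norm_pow_succ_sub_pow_succ_le (a := z) (b := (γ : ℂ)) hz1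
        (by rwa [Complex.norm_real, Real.norm_eq_abs, abs_of_pos (Real.exp_pos _)]) k
      have he : Real.exp (-(c * ξ ^ 2)) ^ k ≤ Real.exp (-(c * (k + 1 : ℕ) / 2 * ξ ^ 2)) := by
        rw [← Real.exp_nat_mul]
        apply Real.exp_le_exp.2
        push_cast at hn' ⊢
        have : 0 ≤ c * ξ ^ 2 := by positivity
        nlinarith
      calc tri R ξ * |(Complex.exp (-(ξ * y * Complex.I)) * (z ^ (k + 1) - (γ : ℂ) ^ (k + 1))).re|
          ≤ 1 * ‖z ^ (k + 1) - (γ : ℂ) ^ (k + 1)‖ :=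
            mul_le_mul (tri_le_one hR ξ) (hre_abs _) (abs_nonneg _) zero_le_one
        _ ≤ (k + 1) * Real.exp (-(c * ξ ^ 2)) ^ k * ‖z - γ‖ := by rw [one_mul]; exact hb
        _ ≤ (k + 1) * Real.exp (-(c * (k + 1 : ℕ) / 2 * ξ ^ 2)) * (D * |ξ| ^ 3) := by gcongr
        _ = _ := by push_cast; ring
    · rw [tri_eq_zero hR (not_le.1 hξ).le, zero_mul]
      positivity
  have h2 : |(1 - tri R ξ) * (Complex.exp (-(ξ * y * Complex.I)) * ((γ : ℂ)) ^ n).re|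
      ≤ |ξ| / R * Real.exp (-(c * n / 2 * ξ ^ 2)) := by
    rw [abs_mul, abs_of_nonneg (by linarith [tri_le_one hR ξ])]
    exact mul_le_mul (one_sub_tri_le R ξ) ((hre_abs _).trans (hγnorm.le.trans hpow_le))
      (abs_nonneg _) (by positivity)
  calc _ ≤ _ := abs_sub _ _
    _ ≤ _ := add_le_add h1 h2
    _ = _ := by ring

lemma integrable_abs_pow_mul_gaussian {b : ℝ} (hb : 0 < b) (k : ℕ) :
    Integrable fun ξ : ℝ => |ξ| ^ k * Real.exp (-(b * ξ ^ 2)) := by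
  have h := (integrable_rpow_mul_exp_neg_mul_sq hb (s := (k : ℝ))
    (by have : (0 : ℝ) ≤ k := by positivity
        linarith)).norm
  refine h.congr (Eventually.of_forall fun ξ => ?_)
  simp only [Real.rpow_natCast, norm_mul, norm_pow, Real.norm_eq_abs, Real.abs_exp, neg_mul]

/-- Uniform local limit theorem for laws smoothed by the Fejér kernel. -/
lemma exists_smoothed_sub_gaussian_le {R c D : ℝ} (hR : 0 < R) (hc : 0 < c) (hD : 0 ≤ D) :
    ∃ E : ℝ, 0 ≤ E ∧ ∀ (μ : Measure ℝ) [IsProbabilityMeasure μ] (n : ℕ) (ψ : ℝ → ℂ) (v : ℝ),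
      2 ≤ n → 2 * c ≤ v → (∀ ξ, charFun μ ξ = ψ ξ ^ n) →
      (∀ ξ, |ξ| ≤ R → ‖ψ ξ‖ ≤ Real.exp (-(c * ξ ^ 2)) ∧
        ‖ψ ξ - (Real.exp (-(v * ξ ^ 2 / 2)) : ℝ)‖ ≤ D * |ξ| ^ 3) →
      ∀ y, |smoothed R μ y - √(2 * Real.pi / (n * v)) * Real.exp (-y ^ 2 / (2 * (n * v)))|
        ≤ E / n := by
  set F : ℝ → ℝ := fun ζ => (D * |ζ| ^ 3 + |ζ| / R) * Real.exp (-(c / 2 * ζ ^ 2)) with hF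
  have hFint : Integrable F := by
    have h3 := (integrable_abs_pow_mul_gaussian (half_pos hc) 3).const_mul D
    have h1 := (integrable_abs_pow_mul_gaussian (half_pos hc) 1).const_mul R⁻¹
    refine (h3.add h1).congr (Eventually.of_forall fun ζ => ?_)
    simp only [hF, Pi.add_apply]
    ring
  refine ⟨∫ ζ, F ζ, integral_nonneg fun ζ => by simp only [hF, Pi.zero_apply]; positivity, ?_⟩
  intro μ _ n ψ v hn hv hchar hψ y
  have hn0 : (0 : ℝ) < n := by exact_mod_cast (by omega : 0 < n)
  have hv0 : 0 < v := by linarith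
  have hb : 0 < n * v / 2 := by positivity
  have hG := integral_gaussian_mul_cos hb y
  have e1 : Real.pi / (n * v / 2) = 2 * Real.pi / (n * v) := by field_simp
  have e2 : 4 * (n * v / 2) = 2 * (n * v) := by ring
  rw [e1, e2] at hG
  rw [← hG, smoothed_eq hR]
  have hi1 : Integrable fun ξ : ℝ =>
      tri R ξ * (Complex.exp (-(ξ * y * Complex.I)) * charFun μ ξ).re := by
    refine (integrable_tri hR).mono' ?_ (Eventually.of_forall fun ξ => ?_)
    · apply Measurable.aestronglyMeasurable
      exact (continuous_tri R).measurable.mul (Complex.measurable_re.comp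
        (Measurable.mul (by fun_prop) measurable_charFun))
    · rw [Real.norm_eq_abs, abs_mul, abs_of_nonneg (tri_nonneg R ξ)]
      refine mul_le_of_le_one_right (tri_nonneg R ξ) ((Complex.abs_re_le_norm _).trans ?_)
      have : -((ξ : ℂ) * y * Complex.I) = ((-(ξ * y) : ℝ) : ℂ) * Complex.I := by
        push_cast
        ring
      rw [norm_mul, this, Complex.norm_exp_ofReal_mul_I, one_mul]
      exact norm_charFun_le_one ξ
  have hi2 : Integrable fun ξ : ℝ => Real.exp (-(n * v / 2) * ξ ^ 2) * Real.cos (ξ * y) := by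
    refine (integrable_exp_neg_mul_sq hb).mono' (by fun_prop) (Eventually.of_forall fun ξ => ?_)
    rw [Real.norm_eq_abs, abs_mul, abs_of_pos (Real.exp_pos _)]
    exact mul_le_of_le_one_right (Real.exp_pos _).le (Real.abs_cos_le_one _)
  rw [← integral_sub hi1 hi2]
  set r : ℝ := √n with hr
  have hr0 : 0 < r := Real.sqrt_pos.2 hn0
  have hrr : r ^ 2 = n := Real.sq_sqrt hn0.le
  have hbound : ∀ ξ : ℝ, ‖tri R ξ * (Complex.exp (-(ξ * y * Complex.I)) * charFun μ ξ).re
      - Real.exp (-(n * v / 2) * ξ ^ 2) * Real.cos (ξ * y)‖ ≤ r⁻¹ * F (r * ξ) := by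
    intro ξ
    rw [hchar, Real.norm_eq_abs]
    refine (abs_tri_mul_sub_gaussian_le hR hc hD hv hn (hψ ξ)).trans (le_of_eq ?_)
    simp only [hF]
    rw [abs_mul, abs_of_pos hr0, mul_pow, mul_pow, hrr, ← hrr]
    field_simp
  refine (norm_integral_le_of_norm_le ((hFint.comp_mul_left' hr0.ne').const_mul r⁻¹)
    (Eventually.of_forall hbound)).trans (le_of_eq ?_)
  rw [integral_const_mul, Measure.integral_comp_mul_left, abs_of_pos (inv_pos.2 hr0), smul_eq_mul,
    ← hrr]
  field_simp

/-- The one-sided exponential. -/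
noncomputable def expTail (s t : ℝ) : ℝ := (Ici 0).indicator (fun t => Real.exp (-(s * t))) t

/-- The mean of the one-sided exponential started at `x`. -/
noncomputable def tailMean (s : ℝ) (μ : Measure ℝ) (x : ℝ) : ℝ := ∫ t, expTail s (t - x) ∂μ

/-- The tail mean smoothed by the Fejér kernel. -/
noncomputable def smoothTail (R s : ℝ) (μ : Measure ℝ) (x : ℝ) : ℝ :=
  ∫ w, tailMean s μ (x + w) * fejer R w

lemma expTail_nonneg (s t : ℝ) : 0 ≤ expTail s t :=
  indicator_nonneg (fun _ _ => (Real.exp_pos _).le) _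

lemma expTail_le_one {s : ℝ} (hs : 0 ≤ s) (t : ℝ) : expTail s t ≤ 1 := by
  refine indicator_le' (fun t ht => ?_) (fun _ _ => zero_le_one) t
  have : 0 ≤ s * t := mul_nonneg hs ht
  exact Real.exp_le_one_iff.2 (by linarith)

lemma measurable_expTail (s : ℝ) : Measurable (expTail s) :=
  Measurable.indicator (by fun_prop) measurableSet_Ici

lemma expTail_sub_le {s x y : ℝ} (hxy : x ≤ y) (t : ℝ) :
    expTail s (t - y) ≤ Real.exp (s * (y - x)) * expTail s (t - x) := by
  unfold expTail
  by_cases h : 0 ≤ t - y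
  · rw [indicator_of_mem (mem_Ici.2 h), indicator_of_mem (mem_Ici.2 (by linarith)),
      ← Real.exp_add]
    exact le_of_eq (congrArg _ (by ring))
  · rw [indicator_of_notMem (by simpa using h)]
    exact mul_nonneg (Real.exp_pos _).le (expTail_nonneg s _)

lemma integrable_expTail_sub {s : ℝ} (hs : 0 ≤ s) (μ : Measure ℝ) [IsProbabilityMeasure μ]
    (x : ℝ) : Integrable (fun t => expTail s (t - x)) μ := by
  refine (integrable_const (1 : ℝ)).mono' ?_ (Eventually.of_forall fun t => ?_)
  · exact ((measurable_expTail s).comp (by fun_prop)).aestronglyMeasurable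
  · rw [Real.norm_eq_abs, abs_of_nonneg (expTail_nonneg _ _)]
    exact expTail_le_one hs _

lemma tailMean_nonneg (s : ℝ) (μ : Measure ℝ) (x : ℝ) : 0 ≤ tailMean s μ x :=
  integral_nonneg fun _ => expTail_nonneg _ _

lemma tailMean_le_one {s : ℝ} (hs : 0 ≤ s) (μ : Measure ℝ) [IsProbabilityMeasure μ] (x : ℝ) :
    tailMean s μ x ≤ 1 := by
  have := integral_mono (integrable_expTail_sub hs μ x) (integrable_const (1 : ℝ))
    fun t => expTail_le_one hs _
  unfold tailMean
  simpa using this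

lemma tailMean_le {s x y : ℝ} (hs : 0 ≤ s) (μ : Measure ℝ) [IsProbabilityMeasure μ]
    (hxy : x ≤ y) : tailMean s μ y ≤ Real.exp (s * (y - x)) * tailMean s μ x := by
  unfold tailMean
  rw [← integral_const_mul]
  exact integral_mono (integrable_expTail_sub hs μ y)
    ((integrable_expTail_sub hs μ x).const_mul _) fun t => expTail_sub_le hxy t

lemma measurable_tailMean (s : ℝ) (μ : Measure ℝ) [IsProbabilityMeasure μ] :
    Measurable (tailMean s μ) := by
  have : StronglyMeasurable (Function.uncurry fun x t : ℝ => expTail s (t - x)) :=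
    ((measurable_expTail s).comp (measurable_snd.sub measurable_fst)).stronglyMeasurable
  exact this.integral_prod_right.measurable

lemma integrable_tailMean_mul_fejer {R s : ℝ} (hR : 0 < R) (hs : 0 ≤ s) (μ : Measure ℝ)
    [IsProbabilityMeasure μ] (x : ℝ) :
    Integrable fun w => tailMean s μ (x + w) * fejer R w := by
  refine (integrable_fejer hR).mono' ?_ (Eventually.of_forall fun w => ?_)
  · exact (((measurable_tailMean s μ).comp (by fun_prop)).mul
      (continuous_fejer hR).measurable).aestronglyMeasurable
  · rw [Real.norm_eq_abs, abs_mul, abs_of_nonneg (tailMean_nonneg _ _ _),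
      abs_of_nonneg (fejer_nonneg hR _)]
    exact mul_le_of_le_one_left (fejer_nonneg hR _) (tailMean_le_one hs μ _)

lemma smoothTail_nonneg {R : ℝ} (hR : 0 < R) (s : ℝ) (μ : Measure ℝ) (x : ℝ) :
    0 ≤ smoothTail R s μ x :=
  integral_nonneg fun _ => mul_nonneg (tailMean_nonneg _ _ _) (fejer_nonneg hR _)

lemma smoothTail_le {R s : ℝ} (hR : 0 < R) (hs : 0 ≤ s) (μ : Measure ℝ) [IsProbabilityMeasure μ]
    (x : ℝ) : smoothTail R s μ x ≤ ∫ y, fejer 1 y := by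
  rw [← integral_fejer hR]
  exact integral_mono (integrable_tailMean_mul_fejer hR hs μ x) (integrable_fejer hR)
    fun w => mul_le_of_le_one_left (fejer_nonneg hR _) (tailMean_le_one hs μ _)

/-- A tail mean is bounded by the smoothed tail mean slightly to its left. -/
lemma mul_tailMean_le_smoothTail {R s a : ℝ} (hR : 0 < R) (hs : 0 ≤ s) (μ : Measure ℝ)
    [IsProbabilityMeasure μ] (x : ℝ) :
    (∫ w in Icc (-a) a, fejer R w) * tailMean s μ x
      ≤ Real.exp (2 * s * a) * smoothTail R s μ (x - a) := by
  have hint := integrable_tailMean_mul_fejer hR hs μ (x - a)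
  have h1 : ∫ w in Icc (-a) a, tailMean s μ (x - a + w) * fejer R w ≤ smoothTail R s μ (x - a) :=
    setIntegral_le_integral hint (Eventually.of_forall fun w =>
      mul_nonneg (tailMean_nonneg _ _ _) (fejer_nonneg hR _))
  refine le_trans ?_ (mul_le_mul_of_nonneg_left h1 (Real.exp_pos _).le)
  rw [← integral_mul_const, ← integral_const_mul]
  refine setIntegral_mono_on ((integrable_fejer hR).integrableOn.mul_const _)
    (hint.integrableOn.const_mul _) measurableSet_Icc fun w hw => ?_
  have h2 := tailMean_le hs μ (x := x - a + w) (y := x) (by linarith [hw.2])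
  have h3 : Real.exp (s * (x - (x - a + w))) ≤ Real.exp (2 * s * a) :=
    Real.exp_le_exp.2 (by nlinarith [hw.1])
  have h4 := h2.trans (mul_le_mul_of_nonneg_right h3 (tailMean_nonneg s μ _))
  calc fejer R w * tailMean s μ x
      ≤ fejer R w * (Real.exp (2 * s * a) * tailMean s μ (x - a + w)) :=
        mul_le_mul_of_nonneg_left h4 (fejer_nonneg hR _)
    _ = _ := by ring

/-- A smoothed tail mean is controlled by the tail mean slightly to its left. -/
lemma smoothTail_le_mul_tailMean_add {R s a B : ℝ} (hR : 0 < R) (hs : 0 ≤ s)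
    (μ : Measure ℝ) [IsProbabilityMeasure μ] (hB : ∀ y, tailMean s μ y ≤ B) (x : ℝ) :
    smoothTail R s μ (x + a) ≤ Real.exp (2 * s * a) * (∫ y, fejer 1 y) * tailMean s μ x
      + ((∫ y, fejer 1 y) - ∫ w in Icc (-a) a, fejer R w) * B := by
  have hint := integrable_tailMean_mul_fejer hR hs μ (x + a)
  have hF := integrable_fejer hR
  have hsplit := integral_add_compl (measurableSet_Icc (a := -a) (b := a)) hint
  have hFsplit := integral_add_compl (measurableSet_Icc (a := -a) (b := a)) hF
  rw [integral_fejer hR] at hFsplit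
  have h1 : ∫ w in Icc (-a) a, tailMean s μ (x + a + w) * fejer R w
      ≤ Real.exp (2 * s * a) * (∫ y, fejer 1 y) * tailMean s μ x := by
    have : ∫ w in Icc (-a) a, tailMean s μ (x + a + w) * fejer R w
        ≤ ∫ w in Icc (-a) a, Real.exp (2 * s * a) * tailMean s μ x * fejer R w := by
      refine setIntegral_mono_on hint.integrableOn (hF.integrableOn.const_mul _)
        measurableSet_Icc fun w hw => ?_
      have h2 := tailMean_le hs μ (x := x) (y := x + a + w) (by linarith [hw.1])
      have h3 : Real.exp (s * (x + a + w - x)) ≤ Real.exp (2 * s * a) :=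
        Real.exp_le_exp.2 (by nlinarith [hw.2])
      exact mul_le_mul_of_nonneg_right
        (h2.trans (mul_le_mul_of_nonneg_right h3 (tailMean_nonneg s μ _))) (fejer_nonneg hR _)
    rw [integral_const_mul] at this
    refine this.trans ?_
    have h5 : ∫ w in Icc (-a) a, fejer R w ≤ ∫ y, fejer 1 y := by
      rw [← integral_fejer hR]
      exact setIntegral_le_integral hF (Eventually.of_forall fun w => fejer_nonneg hR _)
    calc _ ≤ Real.exp (2 * s * a) * tailMean s μ x * ∫ y, fejer 1 y :=
          mul_le_mul_of_nonneg_left h5 (mul_nonneg (Real.exp_pos _).le (tailMean_nonneg _ _ _))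
      _ = _ := by ring
  have h2 : ∫ w in (Icc (-a) a)ᶜ, tailMean s μ (x + a + w) * fejer R w
      ≤ ((∫ y, fejer 1 y) - ∫ w in Icc (-a) a, fejer R w) * B := by
    have : ∫ w in (Icc (-a) a)ᶜ, tailMean s μ (x + a + w) * fejer R w
        ≤ ∫ w in (Icc (-a) a)ᶜ, B * fejer R w :=
      setIntegral_mono_on hint.integrableOn (hF.integrableOn.const_mul _)
        measurableSet_Icc.compl fun w _ => mul_le_mul_of_nonneg_right (hB _) (fejer_nonneg hR _)
    rw [integral_const_mul] at this
    refine this.trans (le_of_eq ?_)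
    rw [← hFsplit]
    ring
  unfold smoothTail
  rw [← hsplit]
  exact add_le_add h1 h2

lemma integrable_expTail_mul_fejer {R s : ℝ} (hR : 0 < R) (hs : 0 ≤ s) (μ : Measure ℝ)
    [IsProbabilityMeasure μ] (x : ℝ) :
    Integrable (Function.uncurry fun t u : ℝ => expTail s u * fejer R (x + u - t))
      (μ.prod volume) := by
  have hcont := continuous_fejer hR
  have hmeas : Measurable (Function.uncurry fun t u : ℝ => expTail s u * fejer R (x + u - t)) :=
    ((measurable_expTail s).comp measurable_snd).mul
      (hcont.measurable.comp ((measurable_const.add measurable_snd).sub measurable_fst))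
  have hshift : ∀ t : ℝ, Integrable fun u => fejer R (x + u - t) := by
    intro t
    have := (integrable_fejer hR).comp_add_left (x - t)
    refine this.congr (Eventually.of_forall fun u => congrArg _ ?_)
    ring
  have hle : ∀ t u : ℝ, ‖expTail s u * fejer R (x + u - t)‖ ≤ fejer R (x + u - t) := by
    intro t u
    rw [Real.norm_eq_abs, abs_mul, abs_of_nonneg (expTail_nonneg _ _),
      abs_of_nonneg (fejer_nonneg hR _)]
    exact mul_le_of_le_one_left (fejer_nonneg hR _) (expTail_le_one hs _)
  have hsec : ∀ t : ℝ, Integrable fun u => expTail s u * fejer R (x + u - t) := fun t =>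
    (hshift t).mono' (hmeas.comp (measurable_const.prodMk measurable_id)).aestronglyMeasurable
      (Eventually.of_forall (hle t))
  rw [integrable_prod_iff hmeas.aestronglyMeasurable]
  refine ⟨Eventually.of_forall hsec, ?_⟩
  refine (integrable_const (∫ y, fejer R y)).mono'
    (hmeas.aestronglyMeasurable.norm.integral_prod_right') (Eventually.of_forall fun t => ?_)
  rw [Real.norm_eq_abs, abs_of_nonneg (integral_nonneg fun _ => norm_nonneg _)]
  refine (integral_mono (hsec t).norm (hshift t) (hle t)).trans (le_of_eq ?_)
  rw [← integral_add_left_eq_self (fejer R) (x - t)]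
  congr 1
  ext u
  congr 1
  ring

lemma integrable_expTail_mul_smoothed {R s : ℝ} (hR : 0 < R) (hs : 0 ≤ s) (μ : Measure ℝ)
    [IsProbabilityMeasure μ] (x : ℝ) :
    Integrable fun u => expTail s u * smoothed R μ (x + u) := by
  refine (integrable_expTail_mul_fejer hR hs μ x).integral_prod_right.congr
    (Eventually.of_forall fun u => ?_)
  simp only [Function.uncurry, smoothed]
  rw [integral_const_mul]

lemma smoothTail_eq {R s : ℝ} (hR : 0 < R) (hs : 0 ≤ s) (μ : Measure ℝ)
    [IsProbabilityMeasure μ] (x : ℝ) :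
    smoothTail R s μ x = ∫ u, expTail s u * smoothed R μ (x + u) := by
  have h1 : ∀ u, expTail s u * smoothed R μ (x + u)
      = ∫ t, expTail s u * fejer R (x + u - t) ∂μ := by
    intro u
    rw [integral_const_mul, smoothed]
  simp_rw [h1]
  rw [← integral_integral_swap (integrable_expTail_mul_fejer hR hs μ x)]
  have h2 : ∀ t, ∫ u, expTail s u * fejer R (x + u - t)
      = ∫ w, expTail s (t - (x + w)) * fejer R w := by
    intro t
    rw [← integral_sub_left_eq_self (fun u => expTail s u * fejer R (x + u - t)) volume (t - x)]
    congr 1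
    ext w
    have e1 : t - x - w = t - (x + w) := by ring
    have e2 : x + (t - x - w) - t = -w := by ring
    rw [e2, e1, fejer_neg]
  simp_rw [h2]
  unfold smoothTail tailMean
  simp_rw [← integral_mul_const]
  rw [integral_integral_swap]
  refine ((integrable_fejer hR).comp_fst μ).mono' ?_ (Eventually.of_forall fun z => ?_)
  · exact (((measurable_expTail s).comp
      (measurable_snd.sub (measurable_const.add measurable_fst))).mul
      ((continuous_fejer hR).measurable.comp measurable_fst)).aestronglyMeasurable
  · simp only [Function.uncurry]
    rw [Real.norm_eq_abs, abs_mul, abs_of_nonneg (expTail_nonneg _ _),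
      abs_of_nonneg (fejer_nonneg hR _)]
    exact mul_le_of_le_one_left (fejer_nonneg hR _) (expTail_le_one hs _)

lemma expTail_eq_indicator (s : ℝ) :
    expTail s = (Ici 0).indicator fun t => Real.exp (-(s * t)) := rfl

lemma integrable_expTail {s : ℝ} (hs : 0 < s) : Integrable (expTail s) := by
  rw [expTail_eq_indicator, integrable_indicator_iff measurableSet_Ici,
    integrableOn_Ici_iff_integrableOn_Ioi]
  simpa only [neg_mul] using integrableOn_exp_mul_Ioi (neg_lt_zero.2 hs) 0

lemma integral_expTail {s : ℝ} (hs : 0 < s) : ∫ t, expTail s t = 1 / s := by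
  rw [expTail_eq_indicator, integral_indicator measurableSet_Ici, integral_Ici_eq_integral_Ioi]
  have := integral_exp_mul_Ioi (neg_lt_zero.2 hs) 0
  simp only [neg_mul] at this
  rw [this]
  simp

lemma smoothTail_mul_le {R s C d : ℝ} (hR : 0 < R) (hs : 0 ≤ s) (hC : 0 ≤ C) (hd : 0 < d)
    (μ : Measure ℝ) [IsProbabilityMeasure μ] (hp : ∀ y, smoothed R μ y ≤ C / d) (x : ℝ) :
    smoothTail R s μ x * (1 + s * d) ≤ (∫ y, fejer 1 y) + C := by
  have h1 := smoothTail_le hR hs μ x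
  rcases hs.eq_or_lt with rfl | hs0
  · linarith
  have h2 : smoothTail R s μ x ≤ C / d * (1 / s) := by
    rw [smoothTail_eq hR hs, ← integral_expTail hs0, ← integral_const_mul]
    refine integral_mono (integrable_expTail_mul_smoothed hR hs μ x)
      ((integrable_expTail hs0).const_mul _) fun u => ?_
    rw [mul_comm]
    exact mul_le_mul_of_nonneg_right (hp _) (expTail_nonneg _ _)
  have h3 : smoothTail R s μ x * (s * d) ≤ C := by
    calc smoothTail R s μ x * (s * d) ≤ C / d * (1 / s) * (s * d) :=
          mul_le_mul_of_nonneg_right h2 (by positivity)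
      _ = C := by field_simp
  linarith

lemma le_smoothTail_zero_mul {R s c d : ℝ} (hR : 0 < R) (hs : 0 ≤ s) (hc : 0 ≤ c) (hd : 0 < d)
    (μ : Measure ℝ) [IsProbabilityMeasure μ]
    (hp : ∀ y ∈ Icc 0 d, c / d ≤ smoothed R μ y) :
    c * Real.exp (-1) ≤ smoothTail R s μ 0 * (1 + s * d) := by
  have hsd : 0 ≤ s * d := mul_nonneg hs hd.le
  set l : ℝ := d / (1 + s * d) with hl
  have hl0 : 0 ≤ l := by positivity
  have hld : l ≤ d := div_le_self hd.le (by linarith)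
  have hint := integrable_expTail_mul_smoothed hR hs μ 0
  have h1 : ∫ u in Icc 0 l, expTail s u * smoothed R μ (0 + u) ≤ smoothTail R s μ 0 := by
    rw [smoothTail_eq hR hs]
    exact setIntegral_le_integral hint (Eventually.of_forall fun u =>
      mul_nonneg (expTail_nonneg _ _) (smoothed_nonneg hR _ _))
  have h2 : ∫ _u in Icc 0 l, Real.exp (-1) * (c / d)
      ≤ ∫ u in Icc 0 l, expTail s u * smoothed R μ (0 + u) := by
    refine setIntegral_mono_on continuous_const.integrableOn_Icc hint.integrableOn
      measurableSet_Icc fun u hu => ?_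
    rw [zero_add]
    refine mul_le_mul ?_ (hp u ⟨hu.1, hu.2.trans hld⟩) (by positivity) (expTail_nonneg _ _)
    unfold expTail
    rw [indicator_of_mem (mem_Ici.2 hu.1)]
    apply Real.exp_le_exp.2
    have : s * u ≤ s * l := mul_le_mul_of_nonneg_left hu.2 hs
    have : s * l ≤ 1 := by
      rw [hl, ← mul_div_assoc, div_le_one (by positivity)]
      linarith
    linarith
  rw [setIntegral_const, measureReal_def, Real.volume_Icc, sub_zero, ENNReal.toReal_ofReal hl0,
    smul_eq_mul] at h2
  calc c * Real.exp (-1) = l * (Real.exp (-1) * (c / d)) * (1 + s * d) := by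
        rw [hl]
        field_simp
    _ ≤ _ := mul_le_mul_of_nonneg_right (h2.trans h1) (by positivity)

lemma exp_mul_smoothTail {R s : ℝ} (hR : 0 < R) (hs : 0 ≤ s) (μ : Measure ℝ)
    [IsProbabilityMeasure μ] (x : ℝ) :
    IntegrableOn (fun u => Real.exp (-(s * u)) * smoothed R μ u) (Ici x) ∧
      Real.exp (-(s * x)) * smoothTail R s μ x
        = ∫ u in Ici x, Real.exp (-(s * u)) * smoothed R μ u := by
  have h : ∀ u, (Ici x).indicator (fun u => Real.exp (-(s * u)) * smoothed R μ u) u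
      = Real.exp (-(s * x)) * (expTail s (-x + u) * smoothed R μ (x + (-x + u))) := by
    intro u
    unfold expTail
    rw [add_neg_cancel_left]
    by_cases hu : x ≤ u
    · rw [indicator_of_mem (mem_Ici.2 hu), indicator_of_mem (mem_Ici.2 (by linarith)), ← mul_assoc,
        ← Real.exp_add]
      congr 2
      ring
    · rw [indicator_of_notMem (by simpa using hu), indicator_of_notMem]
      · ring
      · rw [mem_Ici]
        push Not
        linarith [not_le.1 hu]
  constructor
  · rw [← integrable_indicator_iff measurableSet_Ici]
    exact (((integrable_expTail_mul_smoothed hR hs μ x).comp_add_left (-x)).const_mul _).congr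
      (Eventually.of_forall fun u => (h u).symm)
  · rw [← integral_indicator measurableSet_Ici]
    simp_rw [h]
    rw [integral_const_mul,
      integral_add_left_eq_self (fun u => expTail s u * smoothed R μ (x + u)) (-x),
      smoothTail_eq hR hs]

lemma abs_exp_mul_smoothTail_sub_le {R s C d x y : ℝ} (hR : 0 < R) (hs : 0 ≤ s)
    (μ : Measure ℝ) [IsProbabilityMeasure μ] (hp : ∀ y, smoothed R μ y ≤ C / d) (hxy : x ≤ y) :
    |Real.exp (-(s * x)) * smoothTail R s μ x - Real.exp (-(s * y)) * smoothTail R s μ y|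
      ≤ (y - x) * (Real.exp (-(s * x)) * (C / d)) := by
  obtain ⟨hix, hx⟩ := exp_mul_smoothTail hR hs μ x
  obtain ⟨hiy, hy⟩ := exp_mul_smoothTail hR hs μ y
  have hunion := setIntegral_union (μ := volume) (Set.disjoint_left.2 fun u hu hu' =>
    not_le.2 (mem_Ico.1 hu).2 (mem_Ici.1 hu')) measurableSet_Ici
    (hix.mono_set (Ico_subset_Ici_self : Ico x y ⊆ Ici x)) hiy
  rw [Ico_union_Ici_eq_Ici hxy] at hunion
  rw [hx, hy, hunion, add_sub_cancel_right, ← Real.norm_eq_abs]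
  refine (norm_setIntegral_le_of_norm_le_const (C := Real.exp (-(s * x)) * (C / d)) (by simp)
    fun u hu => ?_).trans (le_of_eq ?_)
  · rw [Real.norm_eq_abs, abs_mul, abs_of_pos (Real.exp_pos _),
      abs_of_nonneg (smoothed_nonneg hR _ _)]
    refine mul_le_mul (Real.exp_le_exp.2 ?_) (hp u) (smoothed_nonneg hR _ _) (Real.exp_pos _).le
    have := mul_le_mul_of_nonneg_left hu.1 hs
    linarith
  · rw [measureReal_def, Real.volume_Ico, ENNReal.toReal_ofReal (by linarith), mul_comm]

/-- Slow variation of the smoothed tail mean. -/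
lemma abs_smoothTail_sub_mul_le {R s C d δ X x : ℝ} (hR : 0 < R) (hs : 0 ≤ s) (hC : 0 ≤ C)
    (hd : 0 < d) (hδ0 : 0 ≤ δ) (hδ : δ ≤ 1) (μ : Measure ℝ) [IsProbabilityMeasure μ]
    (hp : ∀ y, smoothed R μ y ≤ C / d)
    (hvar : ∀ y y', |y - y'| ≤ X → |smoothed R μ y - smoothed R μ y'| ≤ δ / d)
    (hX : X ≤ δ * d) (hx : |x| ≤ X) :
    |smoothTail R s μ x - smoothTail R s μ 0| * (1 + s * d)
      ≤ δ * (2 + 4 * (∫ y, fejer 1 y) + 6 * C) := by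
  set Z := ∫ y, fejer 1 y with hZ
  have hZ0 : 0 < Z := integral_fejer_pos
  rcases le_or_gt 1 (s * d) with hsd | hsd
  · have hs0 : 0 < s := by
      by_contra h
      have : s = 0 := le_antisymm (not_lt.1 h) hs
      rw [this] at hsd
      linarith
    have h1 : |smoothTail R s μ x - smoothTail R s μ 0| ≤ δ / d * (1 / s) := by
      rw [smoothTail_eq hR hs, smoothTail_eq hR hs,
        ← integral_sub (integrable_expTail_mul_smoothed hR hs μ x)
          (integrable_expTail_mul_smoothed hR hs μ 0), ← integral_expTail hs0,
        ← integral_const_mul, ← Real.norm_eq_abs]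
      refine norm_integral_le_of_norm_le ((integrable_expTail hs0).const_mul _)
        (Eventually.of_forall fun u => ?_)
      rw [← mul_sub, Real.norm_eq_abs, abs_mul, abs_of_nonneg (expTail_nonneg _ _), mul_comm]
      refine mul_le_mul_of_nonneg_right (hvar _ _ ?_) (expTail_nonneg _ _)
      rwa [zero_add, add_sub_cancel_right]
    calc |smoothTail R s μ x - smoothTail R s μ 0| * (1 + s * d)
        ≤ δ / d * (1 / s) * (2 * (s * d)) :=
          mul_le_mul h1 (by linarith) (by positivity) (by positivity)
      _ = δ * 2 := by field_simp
      _ ≤ _ := mul_le_mul_of_nonneg_left (by linarith) hδ0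
  · have hsx : s * |x| ≤ δ := by
      have h1 : s * |x| ≤ s * (δ * d) := mul_le_mul_of_nonneg_left (hx.trans hX) hs
      nlinarith
    have hexp_le : Real.exp δ ≤ 3 :=
      (Real.exp_le_exp.2 hδ).trans (by linarith [Real.exp_one_lt_d9])
    have hexp_sub : Real.exp δ - 1 ≤ 2 * δ := by
      have h := Real.abs_exp_sub_one_le (x := δ) (by rwa [abs_of_nonneg hδ0])
      rw [abs_of_nonneg hδ0] at h
      exact (le_abs_self _).trans h
    have hsx' : |-(s * x)| ≤ δ := by rwa [abs_neg, abs_mul, abs_of_nonneg hs]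
    have hA : |Real.exp (-(s * x)) * smoothTail R s μ x - smoothTail R s μ 0| ≤ 3 * δ * C := by
      have key : ∀ z w : ℝ, z ≤ w → w - z ≤ δ * d → -(s * z) ≤ δ →
          |Real.exp (-(s * z)) * smoothTail R s μ z - Real.exp (-(s * w)) * smoothTail R s μ w|
            ≤ 3 * δ * C := by
        intro z w hzw hlen hz
        refine (abs_exp_mul_smoothTail_sub_le hR hs μ hp hzw).trans ?_
        have h3 : Real.exp (-(s * z)) ≤ 3 := (Real.exp_le_exp.2 hz).trans hexp_le
        calc (w - z) * (Real.exp (-(s * z)) * (C / d)) ≤ (δ * d) * (3 * (C / d)) := by gcongr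
          _ = 3 * δ * C := by field_simp
      have hx' := abs_le.1 (hx.trans hX)
      rcases le_total x 0 with h | h
      · have := key x 0 h (by linarith [hx'.1]) ((le_abs_self _).trans hsx')
        simpa using this
      · have := key 0 x h (by linarith [hx'.2]) (by simpa using hδ0)
        rw [abs_sub_comm]
        simpa using this
    have hB : |smoothTail R s μ x - Real.exp (-(s * x)) * smoothTail R s μ x| ≤ 2 * δ * Z := by
      have h1 : smoothTail R s μ x - Real.exp (-(s * x)) * smoothTail R s μ x
          = -((Real.exp (-(s * x)) - 1) * smoothTail R s μ x) := by ring
      rw [h1, abs_neg, abs_mul, abs_of_nonneg (smoothTail_nonneg hR s μ x)]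
      refine mul_le_mul ?_ (smoothTail_le hR hs μ x) (smoothTail_nonneg hR s μ x) (by positivity)
      refine (Real.abs_exp_sub_one_le (hsx'.trans hδ)).trans ?_
      linarith
    have h := abs_sub_le (smoothTail R s μ x) (Real.exp (-(s * x)) * smoothTail R s μ x)
      (smoothTail R s μ 0)
    calc |smoothTail R s μ x - smoothTail R s μ 0| * (1 + s * d)
        ≤ (2 * δ * Z + 3 * δ * C) * 2 :=
          mul_le_mul (h.trans (add_le_add hB hA)) (by linarith) (by positivity) (by positivity)
      _ ≤ _ := by nlinarith

lemma abs_gaussian_sub_le {v : ℝ} (hv : 0 < v) (u w : ℝ) :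
    |Real.exp (-u ^ 2 / (2 * v)) - Real.exp (-w ^ 2 / (2 * v))| ≤ (1 + 1 / v) * |u - w| := by
  have hd : ∀ x ∈ (univ : Set ℝ), HasDerivWithinAt (fun x : ℝ => Real.exp (-x ^ 2 / (2 * v)))
      (Real.exp (-x ^ 2 / (2 * v)) * (-(2 * x) / (2 * v))) univ x := by
    intro x _
    have h : HasDerivAt (fun x : ℝ => -x ^ 2 / (2 * v)) (-(2 * x) / (2 * v)) x := by
      simpa using ((hasDerivAt_pow 2 x).neg.div_const (2 * v))
    exact h.exp.hasDerivWithinAt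
  refine convex_univ.norm_image_sub_le_of_norm_hasDerivWithin_le hd (fun x _ => ?_)
    (mem_univ w) (mem_univ u)
  rw [Real.norm_eq_abs, abs_mul, Real.abs_exp, abs_div, abs_neg, abs_mul, abs_of_pos two_pos,
    abs_of_pos (by positivity : 0 < 2 * v)]
  have h1 : Real.exp (-x ^ 2 / (2 * v)) * (1 + x ^ 2 / (2 * v)) ≤ 1 := by
    have := Real.add_one_le_exp (x ^ 2 / (2 * v))
    calc _ ≤ Real.exp (-x ^ 2 / (2 * v)) * Real.exp (x ^ 2 / (2 * v)) := by
          gcongr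
          linarith
      _ = 1 := by
          rw [← Real.exp_add, ← Real.exp_zero]
          congr 1
          ring
  have h2 : 2 * |x| / (2 * v) ≤ (1 + 1 / v) * (1 + x ^ 2 / (2 * v)) := by
    have h3 : 2 * |x| ≤ 1 + x ^ 2 := by
      have := sq_nonneg (|x| - 1)
      rw [sub_sq, sq_abs] at this
      linarith
    calc 2 * |x| / (2 * v) ≤ (1 + x ^ 2) / (2 * v) := by gcongr
      _ ≤ (1 + x ^ 2) / (2 * v) + (1 + 1 / (2 * v) + 1 / v * (x ^ 2 / (2 * v))) := by
          have : 0 ≤ 1 + 1 / (2 * v) + 1 / v * (x ^ 2 / (2 * v)) := by positivity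
          linarith
      _ = _ := by
          field_simp
          ring
  calc _ ≤ Real.exp (-x ^ 2 / (2 * v)) * ((1 + 1 / v) * (1 + x ^ 2 / (2 * v))) := by gcongr
    _ = (1 + 1 / v) * (Real.exp (-x ^ 2 / (2 * v)) * (1 + x ^ 2 / (2 * v))) := by ring
    _ ≤ (1 + 1 / v) * 1 := by gcongr
    _ = _ := mul_one _

lemma eventually_two_mul_rpow_le_mul_sqrt {β r : ℝ} (hβ : β < 1 / 2) (hr : 0 < r) :
    ∀ᶠ n : ℕ in atTop, 2 * (n : ℝ) ^ β ≤ r * √n := by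
  have h := (tendsto_rpow_neg_atTop (sub_pos.2 hβ)).comp
    (tendsto_natCast_atTop_atTop (R := ℝ))
  filter_upwards [eventually_gt_atTop 0,
    h.eventually (ge_mem_nhds (half_pos hr))] with n hn hnr
  have hn0 : (0 : ℝ) < n := by exact_mod_cast hn
  have h1 : (n : ℝ) ^ β = (n : ℝ) ^ (-(1 / 2 - β)) * √n := by
    rw [Real.sqrt_eq_rpow, ← Real.rpow_add hn0]
    congr 1
    ring
  have h2 : (n : ℝ) ^ (-(1 / 2 - β)) ≤ r / 2 := hnr
  rw [h1]
  nlinarith [Real.sqrt_nonneg (n : ℝ)]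

/-- Bounds of local limit type for the smoothed density, with constants independent of the
bandwidth `R`. -/
lemma eventually_smoothed_bounds {R c D v₀ V β δ : ℝ} (hR : 0 < R) (hc : 0 < c) (hD : 0 ≤ D)
    (hv₀ : 0 < v₀) (hV : 0 < V) (hcv : 2 * c ≤ v₀) (hβ : β < 1 / 2) (hδ : 0 < δ) :
    ∀ᶠ n : ℕ in atTop, 0 < √(n : ℝ) ∧ 2 * (n : ℝ) ^ β ≤ δ * √n ∧
      ∀ (μ : Measure ℝ) [IsProbabilityMeasure μ] (ψ : ℝ → ℂ) (v : ℝ), v₀ ≤ v → v ≤ V →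
      (∀ ξ, charFun μ ξ = ψ ξ ^ n) →
      (∀ ξ, |ξ| ≤ R → ‖ψ ξ‖ ≤ Real.exp (-(c * ξ ^ 2)) ∧
        ‖ψ ξ - (Real.exp (-(v * ξ ^ 2 / 2)) : ℝ)‖ ≤ D * |ξ| ^ 3) →
      (∀ y, smoothed R μ y ≤ (√(2 * Real.pi / v₀) + 1) / √n) ∧
      (∀ y ∈ Icc 0 √(n : ℝ),
        √(2 * Real.pi / V) * Real.exp (-1 / (2 * v₀)) / 2 / √n ≤ smoothed R μ y) ∧
      ∀ y y', |y - y'| ≤ 2 * (n : ℝ) ^ β →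
        |smoothed R μ y - smoothed R μ y'| ≤ δ / √n := by
  obtain ⟨E, hE0, hE⟩ := exists_smoothed_sub_gaussian_le hR hc hD
  set B : ℝ := √(2 * Real.pi / v₀) with hB
  set b : ℝ := √(2 * Real.pi / V) * Real.exp (-1 / (2 * v₀)) with hb
  have hB0 : 0 < B := Real.sqrt_pos.2 (by positivity)
  have hb0 : 0 < b := mul_pos (Real.sqrt_pos.2 (by positivity)) (Real.exp_pos _)
  have hsmall : Tendsto (fun n : ℕ => E / √(n : ℝ)) atTop (nhds 0) :=
    (Real.tendsto_sqrt_atTop.comp tendsto_natCast_atTop_atTop).const_div_atTop E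
  have hη : 0 < min δ (δ / (4 * (B * (1 + 1 / v₀)))) := by positivity
  filter_upwards [eventually_ge_atTop 2,
    hsmall.eventually (ge_mem_nhds (by positivity : 0 < min 1 (min (b / 2) (δ / 4)))),
    eventually_two_mul_rpow_le_mul_sqrt hβ hη] with n hn hEn hX1
  have hn0 : (0 : ℝ) < n := by exact_mod_cast (by omega : 0 < n)
  set d : ℝ := √(n : ℝ) with hd
  have hd0 : 0 < d := Real.sqrt_pos.2 hn0
  have hdd : d ^ 2 = n := Real.sq_sqrt hn0.le
  have hE1 := hEn.trans (min_le_left _ _)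
  have hE2 := hEn.trans ((min_le_right _ _).trans (min_le_left _ _))
  have hE3 := hEn.trans ((min_le_right _ _).trans (min_le_right _ _))
  refine ⟨hd0, hX1.trans (mul_le_mul_of_nonneg_right (min_le_left _ _) hd0.le), ?_⟩
  intro μ _ ψ v hv1 hv2 hchar hψ
  have hv0 : 0 < v := by linarith
  have hLLT := hE μ n ψ v hn (hcv.trans hv1) hchar hψ
  set a : ℝ := √(2 * Real.pi / v) with ha
  have ha0 : 0 < a := Real.sqrt_pos.2 (by positivity)
  have haB : a ≤ B := Real.sqrt_le_sqrt (by gcongr)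
  have haV : √(2 * Real.pi / V) ≤ a := Real.sqrt_le_sqrt (by gcongr)
  have hG : ∀ y, √(2 * Real.pi / (n * v)) * Real.exp (-y ^ 2 / (2 * (n * v)))
      = a * Real.exp (-(y / d) ^ 2 / (2 * v)) / d := by
    intro y
    have h1 : 2 * Real.pi / (n * v) = (2 * Real.pi / v) / n := by field_simp
    have h2 : -y ^ 2 / (2 * (n * v)) = -(y / d) ^ 2 / (2 * v) := by
      rw [div_pow, hdd]
      field_simp
    rw [h1, Real.sqrt_div (by positivity), h2]
    ring
  have hEd : E / n = E / d / d := by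
    rw [← hdd]
    field_simp
  simp_rw [hG, hEd] at hLLT
  refine ⟨fun y => ?_, fun y hy => ?_, fun y y' hyy => ?_⟩
  · have h1 := (abs_le.1 (hLLT y)).2
    have h2 : Real.exp (-(y / d) ^ 2 / (2 * v)) ≤ 1 := by
      apply Real.exp_le_one_iff.2
      apply div_nonpos_of_nonpos_of_nonneg _ (by positivity)
      nlinarith [sq_nonneg (y / d)]
    calc smoothed R μ y ≤ a * Real.exp (-(y / d) ^ 2 / (2 * v)) / d + E / d / d := by linarith
      _ ≤ B * 1 / d + 1 / d := by gcongr
      _ = _ := by ring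
  · have h1 := (abs_le.1 (hLLT y)).1
    have h2 : Real.exp (-1 / (2 * v₀)) ≤ Real.exp (-(y / d) ^ 2 / (2 * v)) := by
      apply Real.exp_le_exp.2
      have h3 : (y / d) ^ 2 ≤ 1 := by
        have h4 : y / d ≤ 1 := (div_le_one hd0).2 hy.2
        have h5 : 0 ≤ y / d := div_nonneg hy.1 hd0.le
        nlinarith
      rw [neg_div, neg_div, neg_le_neg_iff]
      gcongr
    have h3 : b / d ≤ a * Real.exp (-(y / d) ^ 2 / (2 * v)) / d := by
      rw [hb]
      gcongr
    have h4 : E / d / d ≤ b / 2 / d := by gcongr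
    have h5 : b / d = b / 2 / d + b / 2 / d := by ring
    linarith
  · have h1 := hLLT y
    have h2 := hLLT y'
    have h3 : |a * Real.exp (-(y / d) ^ 2 / (2 * v)) / d
        - a * Real.exp (-(y' / d) ^ 2 / (2 * v)) / d| ≤ δ / 4 / d := by
      rw [← sub_div, ← mul_sub, abs_div, abs_mul, abs_of_pos ha0, abs_of_pos hd0]
      have h4 := abs_gaussian_sub_le hv0 (y / d) (y' / d)
      rw [← sub_div, abs_div, abs_of_pos hd0] at h4
      have h5 : |y - y'| / d ≤ δ / (4 * (B * (1 + 1 / v₀))) := by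
        rw [div_le_iff₀ hd0]
        exact (hyy.trans hX1).trans (mul_le_mul_of_nonneg_right (min_le_right _ _) hd0.le)
      have h6 : 1 + 1 / v ≤ 1 + 1 / v₀ := by gcongr
      refine div_le_div_of_nonneg_right ?_ hd0.le
      calc a * |Real.exp (-(y / d) ^ 2 / (2 * v)) - Real.exp (-(y' / d) ^ 2 / (2 * v))|
          ≤ B * ((1 + 1 / v₀) * (δ / (4 * (B * (1 + 1 / v₀))))) := by
            refine mul_le_mul haB (h4.trans ?_) (abs_nonneg _) hB0.le
            exact mul_le_mul h6 h5 (by positivity) (by positivity)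
        _ = δ / 4 := by field_simp
    have h4 : E / d / d ≤ δ / 4 / d := by gcongr
    have h5 : δ / d = δ / 4 / d + δ / 4 / d + δ / 4 / d + δ / 4 / d := by ring
    have h6 : 0 < δ / 4 / d := by positivity
    rw [abs_le] at h1 h2 h3 ⊢
    constructor <;> linarith [h1.1, h1.2, h2.1, h2.2, h3.1, h3.2]

lemma abs_div_sub_one_le_of_sandwich {θ p q t : ℝ} (hθ0 : 0 < θ) (hθ : θ ≤ 1 / 20) (ht : 0 < t)
    (hp1 : (1 - θ) * p ≤ (1 + θ) ^ 2 * t) (hp2 : (1 - 2 * θ) * t ≤ (1 + θ) * p)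
    (hq1 : (1 - θ) * q ≤ (1 + θ) ^ 2 * t) (hq2 : (1 - 2 * θ) * t ≤ (1 + θ) * q) :
    0 < q ∧ |p / q - 1| ≤ 8 * θ := by
  have hq : 0 < q := by
    have : 0 < (1 - 2 * θ) * t := mul_pos (by linarith) ht
    by_contra h
    nlinarith
  have key : ∀ p q : ℝ, 0 < q → (1 - θ) * p ≤ (1 + θ) ^ 2 * t →
      (1 - 2 * θ) * t ≤ (1 + θ) * q → (1 - 3 * θ) * p ≤ (1 + 4 * θ) * q := by
    intro p q hq h1 h2
    have h3 : (1 - 2 * θ) * ((1 - θ) * p) ≤ (1 + θ) ^ 2 * ((1 + θ) * q) := by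
      calc _ ≤ (1 - 2 * θ) * ((1 + θ) ^ 2 * t) := mul_le_mul_of_nonneg_left h1 (by linarith)
        _ = (1 + θ) ^ 2 * ((1 - 2 * θ) * t) := by ring
        _ ≤ _ := mul_le_mul_of_nonneg_left h2 (by positivity)
    have h4 : (1 + θ) ^ 3 ≤ 1 + 4 * θ := by nlinarith [sq_nonneg θ]
    have h5 : (1 + θ) ^ 3 * q ≤ (1 + 4 * θ) * q := mul_le_mul_of_nonneg_right h4 hq.le
    rcases le_total p 0 with h | h
    · have : (1 - 3 * θ) * p ≤ 0 := mul_nonpos_of_nonneg_of_nonpos (by linarith) h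
      have : 0 ≤ (1 + 4 * θ) * q := by positivity
      linarith
    · nlinarith [mul_nonneg (sq_nonneg θ) h]
  have hp : 0 < p := by
    have : 0 < (1 - 2 * θ) * t := mul_pos (by linarith) ht
    by_contra h
    nlinarith
  refine ⟨hq, ?_⟩
  have h1 := key p q hq hp1 hq2
  have h2 := key q p hp hq1 hp2
  rw [abs_le]
  constructor
  · rw [neg_le_sub_iff_le_add, ← sub_le_iff_le_add, le_div_iff₀ hq]
    nlinarith
  · rw [sub_le_iff_le_add, div_le_iff₀ hq]
    nlinarith

/-- The tail mean of a law whose characteristic function is an `n`-th power is asymptotically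
invariant under shifts of size `n ^ β`, `β < 1 / 2`, uniformly in the decay rate `s`. -/
theorem exists_tailMean_ratio {v₀ V S β ε : ℝ} {c D : ℝ → ℝ} (hv₀ : 0 < v₀) (hV : 0 < V)
    (hS : 0 ≤ S) (hβ0 : 0 ≤ β) (hβ : β < 1 / 2) (hε : 0 < ε)
    (hc : ∀ R, 0 < R → 0 < c R ∧ 2 * c R ≤ v₀) (hD : ∀ R, 0 < R → 0 ≤ D R) :
    ∃ n₀ : ℕ, ∀ n : ℕ, n₀ ≤ n →
      ∀ (μ : Measure ℝ) [IsProbabilityMeasure μ] (ψ : ℝ → ℂ) (v s : ℝ), v₀ ≤ v → v ≤ V →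
      0 ≤ s → s ≤ S → (∀ ξ, charFun μ ξ = ψ ξ ^ n) →
      (∀ R, 0 < R → ∀ ξ, |ξ| ≤ R → ‖ψ ξ‖ ≤ Real.exp (-(c R * ξ ^ 2)) ∧
        ‖ψ ξ - (Real.exp (-(v * ξ ^ 2 / 2)) : ℝ)‖ ≤ D R * |ξ| ^ 3) →
      ∀ x, |x| ≤ (n : ℝ) ^ β → 0 < tailMean s μ 0 ∧
        |tailMean s μ x / tailMean s μ 0 - 1| ≤ ε := by
  set Z := ∫ y, fejer 1 y with hZ
  have hZ0 : 0 < Z := integral_fejer_pos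
  set C : ℝ := √(2 * Real.pi / v₀) + 1 with hC
  have hC0 : 0 < C := by positivity
  set b : ℝ := √(2 * Real.pi / V) * Real.exp (-1 / (2 * v₀)) / 2 with hb
  have hb0 : 0 < b := by positivity
  set b' : ℝ := b * Real.exp (-1) with hb'
  have hb'0 : 0 < b' := by positivity
  set θ : ℝ := min ε 1 / 20 with hθ
  have hθ0 : 0 < θ := by positivity
  have hθ1 : θ ≤ 1 / 20 := div_le_div_of_nonneg_right (min_le_right _ _) (by norm_num)
  have hθε : 8 * θ ≤ ε := by
    have : θ ≤ ε / 20 := div_le_div_of_nonneg_right (min_le_left _ _) (by norm_num)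
    linarith
  set a : ℝ := Real.log (1 + θ) / (2 * (S + 1)) with ha
  have hlog0 : 0 < Real.log (1 + θ) := Real.log_pos (by linarith)
  have hlog1 : Real.log (1 + θ) ≤ 1 := (Real.log_le_sub_one_of_pos (by linarith)).trans (by linarith)
  have ha0 : 0 < a := by positivity
  have ha1 : a ≤ 1 := by
    rw [ha, div_le_one (by positivity)]
    linarith
  have haS : ∀ s, 0 ≤ s → s ≤ S → Real.exp (2 * s * a) ≤ 1 + θ := by
    intro s hs0 hs
    rw [← Real.le_log_iff_exp_le (by linarith), ha, ← mul_div_assoc, div_le_iff₀ (by positivity)]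
    nlinarith
  set κ : ℝ := min (θ * Z) (θ * Z * b' / (4 * (Z + C))) with hκ
  have hκ0 : 0 < κ := by positivity
  have hκ1 : κ ≤ θ * Z := min_le_left _ _
  have hκ2 : κ * (4 * (Z + C)) ≤ θ * Z * b' := by
    rw [← le_div_iff₀ (by positivity)]
    exact min_le_right _ _
  set δ : ℝ := min 1 (θ * b' / (2 + 4 * Z + 6 * C)) with hδ
  have hδ0 : 0 < δ := by positivity
  have hδ2 : δ * (2 + 4 * Z + 6 * C) ≤ θ * b' := by
    rw [← le_div_iff₀ (by positivity)]
    exact min_le_right _ _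
  obtain ⟨R, hR, hJ⟩ := exists_fejer_concentrated ha0 hκ0
  rw [← hZ] at hJ
  set J : ℝ := ∫ y in Icc (-a) a, fejer R y with hJdef
  obtain ⟨n₀, hn₀⟩ := eventually_atTop.1 ((eventually_smoothed_bounds (V := V) hR (hc R hR).1
    (hD R hR) hv₀ hV (hc R hR).2 hβ hδ0).and (eventually_ge_atTop 1))
  refine ⟨n₀, fun n hn μ _ ψ v s hv1 hv2 hs0 hsS hchar hψ => ?_⟩
  obtain ⟨⟨hd0, hX, hbounds⟩, hn1⟩ := hn₀ n hn
  obtain ⟨hpU, hpL, hpV⟩ := hbounds μ ψ v hv1 hv2 hchar (hψ R hR)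
  set d : ℝ := √(n : ℝ) with hd
  have hn1' : (1 : ℝ) ≤ (n : ℝ) ^ β := Real.one_le_rpow (by exact_mod_cast hn1) hβ0
  set L : ℝ := 1 + s * d with hL
  have hL0 : 0 < L := by positivity
  set T := smoothTail R s μ with hT
  have hTU : ∀ x, T x * L ≤ Z + C := smoothTail_mul_le hR hs0 hC0.le hd0 μ hpU
  have hTL : b' ≤ T 0 * L := le_smoothTail_zero_mul hR hs0 hb0.le hd0 μ hpL
  have hT0 : 0 < T 0 := by
    by_contra h
    nlinarith
  have hTV : ∀ x, |x| ≤ 2 * (n : ℝ) ^ β → |T x - T 0| ≤ θ * T 0 := by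
    intro x hx
    have h1 := abs_smoothTail_sub_mul_le hR hs0 hC0.le hd0 hδ0.le (min_le_left _ _) μ hpU hpV hX hx
    rw [← hZ] at h1
    have h2 : |T x - T 0| * L ≤ θ * T 0 * L := by
      calc _ ≤ _ := h1
        _ ≤ θ * b' := hδ2
        _ ≤ θ * (T 0 * L) := by gcongr
        _ = _ := by ring
    exact le_of_mul_le_mul_right h2 hL0
  have hZJ : Z / 2 ≤ J := by nlinarith
  have hup : ∀ x, J * tailMean s μ x ≤ (1 + θ) * T (x - a) := fun x =>
    (mul_tailMean_le_smoothTail hR hs0 μ x).trans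
      (mul_le_mul_of_nonneg_right (haS s hs0 hsS) (smoothTail_nonneg hR s μ _))
  set M : ℝ := 4 * (Z + C) / (Z * L) with hM
  have hAM : ∀ x, tailMean s μ x ≤ M := by
    intro x
    rw [hM, le_div_iff₀ (by positivity)]
    have h1 := hup x
    have h2 : (1 + θ) * T (x - a) ≤ 2 * T (x - a) :=
      mul_le_mul_of_nonneg_right (by linarith) (smoothTail_nonneg hR s μ _)
    have h3 : Z / 2 * tailMean s μ x ≤ J * tailMean s μ x :=
      mul_le_mul_of_nonneg_right hZJ (tailMean_nonneg _ _ _)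
    have h4 : Z * tailMean s μ x * L ≤ 4 * T (x - a) * L :=
      mul_le_mul_of_nonneg_right (by linarith) hL0.le
    have h5 := hTU (x - a)
    linarith
  have hκM : κ * M ≤ θ * T 0 := by
    rw [hM, ← mul_div_assoc, div_le_iff₀ (by positivity)]
    calc _ ≤ θ * Z * b' := hκ2
      _ ≤ θ * Z * (T 0 * L) := by gcongr
      _ = _ := by ring
  have hM0 : 0 ≤ M := by positivity
  have hsand : ∀ x, |x| ≤ (n : ℝ) ^ β → (1 - θ) * (Z * tailMean s μ x) ≤ (1 + θ) ^ 2 * T 0 ∧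
      (1 - 2 * θ) * T 0 ≤ (1 + θ) * (Z * tailMean s μ x) := by
    intro x hx
    have hx' := abs_le.1 hx
    have hl := abs_le.1 (hTV (x - a) (abs_le.2 ⟨by linarith, by linarith⟩))
    have hr := abs_le.1 (hTV (x + a) (abs_le.2 ⟨by linarith, by linarith⟩))
    have hA := tailMean_nonneg s μ x
    constructor
    · have h1 : (1 - θ) * Z * tailMean s μ x ≤ J * tailMean s μ x :=
        mul_le_mul_of_nonneg_right (by linarith) hA
      have h2 : (1 + θ) * T (x - a) ≤ (1 + θ) * ((1 + θ) * T 0) :=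
        mul_le_mul_of_nonneg_left (by linarith [hl.2]) (by linarith)
      linarith [hup x]
    · have h1 := smoothTail_le_mul_tailMean_add (a := a) hR hs0 μ hAM x
      rw [← hZ, ← hJdef] at h1
      have h2 : (Z - J) * M ≤ κ * M := mul_le_mul_of_nonneg_right (by linarith) hM0
      have h3 : Real.exp (2 * s * a) * Z * tailMean s μ x ≤ (1 + θ) * (Z * tailMean s μ x) := by
        rw [mul_assoc]
        exact mul_le_mul_of_nonneg_right (haS s hs0 hsS) (by positivity)
      have h4 : T (x + a) = smoothTail R s μ (x + a) := rfl
      linarith [hr.1]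
  intro x hx
  obtain ⟨h1, h2⟩ := hsand x hx
  obtain ⟨h3, h4⟩ := hsand 0 (by simp; positivity)
  obtain ⟨h5, h6⟩ := abs_div_sub_one_le_of_sandwich hθ0 hθ1 hT0 h1 h2 h3 h4
  rw [mul_div_mul_left _ _ hZ0.ne'] at h6
  exact ⟨pos_of_mul_pos_right h5 hZ0.le, h6.trans hθε⟩

lemma norm_cexp_ofReal_mul_I_sub_le (x : ℝ) :
    ‖Complex.exp (x * Complex.I) - (((1 - x ^ 2 / 2 : ℝ) : ℂ) + (x : ℂ) * Complex.I)‖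
      ≤ 4 * |x| ^ 3 := by
  rcases le_or_gt |x| 1 with h | h
  · have h1 := Complex.norm_exp_sub_sum_le_norm_mul_exp (x * Complex.I) 3
    simp only [Finset.sum_range_succ, Finset.sum_range_zero, norm_mul, Complex.norm_I, mul_one,
      Complex.norm_real, Real.norm_eq_abs, mul_pow, Complex.I_sq] at h1
    have h2 : Real.exp |x| ≤ 3 := (Real.exp_le_exp.2 h).trans Real.exp_one_lt_three.le
    refine le_trans (le_of_eq ?_) (h1.trans ?_)
    · congr 2
      push_cast
      simp [Nat.factorial]
      ring
    · have : 0 ≤ |x| ^ 3 := by positivity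
      nlinarith
  · have h1 : ‖Complex.exp (x * Complex.I)‖ = 1 := Complex.norm_exp_ofReal_mul_I x
    have h2 : ‖((1 - x ^ 2 / 2 : ℝ) : ℂ)‖ ≤ 1 + |x| ^ 2 / 2 := by
      rw [Complex.norm_real, Real.norm_eq_abs, sq_abs, abs_le]
      constructor <;> nlinarith [sq_nonneg x]
    have h3 : ‖(x : ℂ) * Complex.I‖ = |x| := by simp
    have h4 := norm_sub_le (Complex.exp (x * Complex.I))
      (((1 - x ^ 2 / 2 : ℝ) : ℂ) + (x : ℂ) * Complex.I)
    have h5 := norm_add_le ((1 - x ^ 2 / 2 : ℝ) : ℂ) ((x : ℂ) * Complex.I)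
    have h6 : |x| ≤ |x| ^ 3 := le_self_pow₀ h.le (by norm_num)
    have h7 : |x| ^ 2 ≤ |x| ^ 3 := pow_le_pow_right₀ h.le (by norm_num)
    linarith

/-- Second order Taylor bound for the characteristic function of a centered law. -/
lemma norm_charFun_sub_quadratic_le {ρ : Measure ℝ} [IsProbabilityMeasure ρ] {B : ℝ}
    (h3 : Integrable (fun u => |u| ^ 3) ρ) (hB : ∫ u, |u| ^ 3 ∂ρ ≤ B) (h0 : ∫ u, u ∂ρ = 0)
    (ξ : ℝ) :
    ‖charFun ρ ξ - ((1 - (∫ u, u ^ 2 ∂ρ) * ξ ^ 2 / 2 : ℝ) : ℂ)‖ ≤ 4 * B * |ξ| ^ 3 := by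
  have hi1 : Integrable (fun u : ℝ => u) ρ := by
    refine ((integrable_const 1).add h3).mono' (by fun_prop) (Eventually.of_forall fun u => ?_)
    rw [Real.norm_eq_abs, Pi.add_apply]
    have := abs_nonneg u
    rcases le_total |u| 1 with h | h
    · have : 0 ≤ |u| ^ 3 := by positivity
      linarith
    · have : |u| ≤ |u| ^ 3 := le_self_pow₀ h (by norm_num)
      linarith
  have hi2 : Integrable (fun u : ℝ => u ^ 2) ρ := by
    refine ((integrable_const 1).add h3).mono' (by fun_prop) (Eventually.of_forall fun u => ?_)
    rw [Real.norm_eq_abs, Pi.add_apply, abs_pow]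
    have := abs_nonneg u
    rcases le_total |u| 1 with h | h
    · have : 0 ≤ |u| ^ 3 := by positivity
      have : |u| ^ 2 ≤ 1 := pow_le_one₀ (abs_nonneg _) h
      linarith
    · have : |u| ^ 2 ≤ |u| ^ 3 := pow_le_pow_right₀ h (by norm_num)
      linarith
  have hre : Integrable (fun u : ℝ => 1 - (ξ * u) ^ 2 / 2) ρ := by
    refine (integrable_const 1).sub ?_
    simp_rw [mul_pow]
    exact (hi2.const_mul _).div_const _
  have hreC : Integrable (fun u : ℝ => ((1 - (ξ * u) ^ 2 / 2 : ℝ) : ℂ)) ρ := hre.ofReal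
  have him : Integrable (fun u : ℝ => ((ξ * u : ℝ) : ℂ) * Complex.I) ρ :=
    ((hi1.const_mul ξ).ofReal).mul_const _
  have hquad : ∫ u, (((1 - (ξ * u) ^ 2 / 2 : ℝ) : ℂ) + ((ξ * u : ℝ) : ℂ) * Complex.I) ∂ρ
      = ((1 - (∫ u, u ^ 2 ∂ρ) * ξ ^ 2 / 2 : ℝ) : ℂ) := by
    rw [integral_add hreC him, integral_complex_ofReal, integral_mul_const,
      integral_complex_ofReal, integral_const_mul, h0]
    simp_rw [mul_pow]
    rw [integral_sub (integrable_const 1) ((hi2.const_mul _).div_const _), integral_div,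
      integral_const_mul]
    simp
    ring
  have hexp : Integrable (fun u : ℝ => Complex.exp (((ξ * u : ℝ) : ℂ) * Complex.I)) ρ := by
    refine (integrable_const (1 : ℝ)).mono' (by fun_prop) (Eventually.of_forall fun u => ?_)
    rw [Complex.norm_exp_ofReal_mul_I]
  have hchar : charFun ρ ξ = ∫ u, Complex.exp (((ξ * u : ℝ) : ℂ) * Complex.I) ∂ρ := by
    rw [charFun_apply_real]
    push_cast
    rfl
  have hquadi : Integrable
      (fun u : ℝ => ((1 - (ξ * u) ^ 2 / 2 : ℝ) : ℂ) + ((ξ * u : ℝ) : ℂ) * Complex.I) ρ :=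
    hreC.add him
  rw [hchar, ← hquad, ← integral_sub hexp hquadi]
  refine (norm_integral_le_of_norm_le (h3.const_mul (4 * |ξ| ^ 3))
    (Eventually.of_forall fun u => ?_)).trans ?_
  · refine (norm_cexp_ofReal_mul_I_sub_le (ξ * u)).trans (le_of_eq ?_)
    rw [abs_mul]
    ring
  · rw [integral_const_mul]
    have : 0 ≤ |ξ| ^ 3 := by positivity
    nlinarith

lemma abs_exp_neg_sub_le {x : ℝ} (hx : 0 ≤ x) : |1 - x - Real.exp (-x)| ≤ x ^ 2 := by
  have h1 := Real.add_one_le_exp (-x)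
  have h2 : Real.exp (-x) ≤ 1 - x + x ^ 2 := by
    have h3 : Real.exp (-x) * (1 + x) ≤ 1 := by
      calc _ ≤ Real.exp (-x) * Real.exp x := by
            gcongr
            linarith [Real.add_one_le_exp x]
        _ = 1 := by rw [← Real.exp_add]; simp
    have h4 : (1 - x + x ^ 2 - Real.exp (-x)) * (1 + x) ≥ 0 := by
      have : 0 ≤ x ^ 3 := by positivity
      nlinarith
    by_contra h
    nlinarith
  rw [abs_le]
  constructor <;> linarith [sq_nonneg x]

lemma integral_sq_le_one_add {ρ : Measure ℝ} [IsProbabilityMeasure ρ] {B : ℝ}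
    (h3 : Integrable (fun u => |u| ^ 3) ρ) (hB : ∫ u, |u| ^ 3 ∂ρ ≤ B) :
    ∫ u, u ^ 2 ∂ρ ≤ 1 + B := by
  calc ∫ u, u ^ 2 ∂ρ ≤ ∫ u, (1 + |u| ^ 3) ∂ρ := by
        refine integral_mono_of_nonneg (Eventually.of_forall fun u => sq_nonneg u)
          ((integrable_const 1).add h3) (Eventually.of_forall fun u => ?_)
        simp only
        rw [← sq_abs]
        rcases le_total |u| 1 with h | h
        · have : 0 ≤ |u| ^ 3 := by positivity
          have : |u| ^ 2 ≤ 1 := pow_le_one₀ (abs_nonneg _) h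
          linarith
        · have : |u| ^ 2 ≤ |u| ^ 3 := pow_le_pow_right₀ h (by norm_num)
          linarith
    _ = 1 + ∫ u, |u| ^ 3 ∂ρ := by
        rw [integral_add (integrable_const 1) h3]
        simp
    _ ≤ _ := by linarith

lemma norm_charFun_sub_gaussian_le {ρ : Measure ℝ} [IsProbabilityMeasure ρ] {B R ξ : ℝ}
    (h3 : Integrable (fun u => |u| ^ 3) ρ) (hB : ∫ u, |u| ^ 3 ∂ρ ≤ B) (h0 : ∫ u, u ∂ρ = 0)
    (hξ : |ξ| ≤ R) :
    ‖charFun ρ ξ - (Real.exp (-((∫ u, u ^ 2 ∂ρ) * ξ ^ 2 / 2)) : ℝ)‖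
      ≤ (4 * B + (1 + B) ^ 2 * R) * |ξ| ^ 3 := by
  have h1 := norm_charFun_sub_quadratic_le h3 hB h0 ξ
  have h2 := integral_sq_le_one_add h3 hB
  set v := ∫ u, u ^ 2 ∂ρ with hv
  have hv0 : 0 ≤ v := integral_nonneg fun u => sq_nonneg u
  have h4 := abs_exp_neg_sub_le (x := v * ξ ^ 2 / 2) (by positivity)
  have h5 : (v * ξ ^ 2 / 2) ^ 2 ≤ (1 + B) ^ 2 * R * |ξ| ^ 3 := by
    calc (v * ξ ^ 2 / 2) ^ 2 = v ^ 2 * |ξ| * |ξ| ^ 3 / 4 := by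
          rw [← sq_abs ξ]
          ring
      _ ≤ v ^ 2 * |ξ| * |ξ| ^ 3 := by
          have : 0 ≤ v ^ 2 * |ξ| * |ξ| ^ 3 := by positivity
          linarith
      _ ≤ _ := by gcongr
  calc _ = ‖(charFun ρ ξ - ((1 - v * ξ ^ 2 / 2 : ℝ) : ℂ)) +
        ((1 - v * ξ ^ 2 / 2 - Real.exp (-(v * ξ ^ 2 / 2)) : ℝ) : ℂ)‖ := by
        congr 1
        push_cast
        ring
    _ ≤ 4 * B * |ξ| ^ 3 + (1 + B) ^ 2 * R * |ξ| ^ 3 := by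
        refine (norm_add_le _ _).trans (add_le_add h1 ?_)
        rw [Complex.norm_real, Real.norm_eq_abs]
        exact h4.trans h5
    _ = _ := by ring

/-- A quadratic decay bound of the characteristic function near the origin bounds the variance
from below. -/
lemma two_mul_le_variance_of_charFun_le {ρ : Measure ℝ} [IsProbabilityMeasure ρ] {B c : ℝ}
    (h3 : Integrable (fun u => |u| ^ 3) ρ) (hB : ∫ u, |u| ^ 3 ∂ρ ≤ B) (h0 : ∫ u, u ∂ρ = 0)
    (hc : ∀ ξ, |ξ| ≤ 1 → ‖charFun ρ ξ‖ ≤ 1 - c * ξ ^ 2) :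
    2 * c ≤ ∫ u, u ^ 2 ∂ρ := by
  have hB0 : 0 ≤ B := le_trans (integral_nonneg fun u => by positivity) hB
  by_contra! h
  set v := ∫ u, u ^ 2 ∂ρ with hv
  set ξ : ℝ := min 1 ((2 * c - v) / (16 * (B + 1))) with hξ
  have hd : 0 < 2 * c - v := by linarith
  have hξ0 : 0 < ξ := by positivity
  have hξ1 : ξ * (16 * (B + 1)) ≤ 2 * c - v := by
    rw [← le_div_iff₀ (by positivity)]
    exact min_le_right _ _
  have h1 := norm_charFun_sub_quadratic_le h3 hB h0 ξ
  have h2 := hc ξ (by rw [abs_of_pos hξ0]; exact min_le_left _ _)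
  rw [abs_of_pos hξ0] at h1
  have h4 : 1 - v * ξ ^ 2 / 2 ≤ ‖((1 - v * ξ ^ 2 / 2 : ℝ) : ℂ)‖ := by
    rw [Complex.norm_real]
    exact le_abs_self _
  have h5 := norm_sub_norm_le ((1 - v * ξ ^ 2 / 2 : ℝ) : ℂ) (charFun ρ ξ)
  rw [norm_sub_rev] at h5
  have h6 : ξ ^ 2 * (2 * c - v) ≤ ξ ^ 2 * (8 * B * ξ) := by nlinarith
  have h7 := le_of_mul_le_mul_left h6 (by positivity)
  nlinarith

lemma Continuous.integrable_of_ae_mem_Icc {σ : Measure ℝ} [IsFiniteMeasure σ] {a b : ℝ}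
    (hσ : ∀ᵐ u ∂σ, u ∈ Icc a b) {f : ℝ → ℝ} (hf : Continuous f) : Integrable f σ := by
  obtain ⟨C, hC⟩ := isCompact_Icc.exists_bound_of_continuousOn (s := Icc a b) hf.continuousOn
  exact Integrable.of_bound hf.aestronglyMeasurable C (hσ.mono hC)

/-- The characteristic function of an atomless measure supported in a short interval decays
quadratically near the origin. -/
lemma exists_norm_charFun_le_of_ae_mem_Icc {σ : Measure ℝ} [IsFiniteMeasure σ] [NullSingletonClass σ]
    (hσ0 : σ ≠ 0) {a b R : ℝ} (hσ : ∀ᵐ u ∂σ, u ∈ Icc a b) (hR : R * (b - a) ≤ Real.pi) :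
    ∃ c, 0 < c ∧ ∀ ξ, |ξ| ≤ R → ‖charFun σ ξ‖ ≤ σ.real univ - c * ξ ^ 2 := by
  have hint : ∀ {f : ℝ → ℝ}, Continuous f → Integrable f σ := fun hf =>
    hf.integrable_of_ae_mem_Icc hσ
  have hpos : 0 < σ univ := Measure.measure_univ_pos.2 hσ0
  set W := σ.real univ with hW
  have hW0 : 0 < W := ENNReal.toReal_pos hpos.ne' (measure_ne_top _ _)
  set J : ℝ → ℝ := fun u => ∫ w, (u - w) ^ 2 ∂σ with hJ
  have hJpos : ∀ u, 0 < J u := by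
    intro u
    refine (integral_pos_iff_support_of_nonneg (fun w => sq_nonneg _)
      (hint (f := fun w => (u - w) ^ 2) (by fun_prop))).2 ?_
    have : Function.support (fun w => (u - w) ^ 2) = {u}ᶜ := by
      ext w
      simp [sub_eq_zero, eq_comm]
    rw [this, measure_compl (measurableSet_singleton u) (measure_ne_top _ _), measure_singleton,
      tsub_zero]
    exact hpos
  have hJc : Continuous J := by
    have : J = fun u => u ^ 2 * W - 2 * u * (∫ w, w ∂σ) + ∫ w, w ^ 2 ∂σ := by
      ext u
      have h1 : ∀ w, (u - w) ^ 2 = u ^ 2 - 2 * u * w + w ^ 2 := fun w => by ring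
      simp only [hJ, h1]
      rw [integral_add (hint (by fun_prop)) (hint (by fun_prop)),
        integral_sub (integrable_const _) (hint (by fun_prop)), integral_const_mul]
      simp [hW, mul_comm]
    rw [this]
    fun_prop
  have hQ : 0 < ∫ u, J u ∂σ := by
    refine (integral_pos_iff_support_of_nonneg (fun w => (hJpos w).le) (hint hJc)).2 ?_
    rwa [Function.support_eq_univ (f := J) fun u => (hJpos u).ne']
  set Q := ∫ u, J u ∂σ with hQdef
  refine ⟨2 / Real.pi ^ 2 * Q / (2 * W), by positivity, fun ξ hξ => ?_⟩
  set C := ∫ u, Real.cos (ξ * u) ∂σ with hC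
  set D := ∫ u, Real.sin (ξ * u) ∂σ with hD
  have hF : charFun σ ξ = C + D * Complex.I := by
    rw [charFun_apply_real, hC, hD, ← integral_complex_ofReal, ← integral_complex_ofReal,
      ← integral_mul_const, ← integral_add]
    · refine integral_congr_ae (Eventually.of_forall fun u => ?_)
      simp only
      rw [Complex.exp_mul_I]
      push_cast
      rfl
    · exact (hint (f := fun u => Real.cos (ξ * u)) (by fun_prop)).ofReal
    · exact ((hint (f := fun u => Real.sin (ξ * u)) (by fun_prop)).ofReal).mul_const _
  have hnorm : ‖charFun σ ξ‖ ^ 2 = C ^ 2 + D ^ 2 := by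
    rw [hF, Complex.sq_norm, Complex.normSq_add_mul_I]
  have hle : ‖charFun σ ξ‖ ≤ W := norm_charFun_le ξ
  have hinner : ∀ᵐ u ∂σ, 2 / Real.pi ^ 2 * ξ ^ 2 * J u
      ≤ W - (Real.cos (ξ * u) * C + Real.sin (ξ * u) * D) := by
    filter_upwards [hσ] with u hu
    calc 2 / Real.pi ^ 2 * ξ ^ 2 * J u
        = ∫ w, 2 / Real.pi ^ 2 * ξ ^ 2 * (u - w) ^ 2 ∂σ := (integral_const_mul _ _).symm
      _ ≤ ∫ w, (1 - (Real.cos (ξ * u) * Real.cos (ξ * w)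
            + Real.sin (ξ * u) * Real.sin (ξ * w))) ∂σ := by
          refine integral_mono_ae (hint (by fun_prop)) (hint (by fun_prop)) ?_
          filter_upwards [hσ] with w hw
          have h1 : |ξ * (u - w)| ≤ Real.pi := by
            rw [abs_mul]
            refine le_trans ?_ hR
            have : |u - w| ≤ b - a := abs_le.2 ⟨by linarith [hu.1, hw.2], by linarith [hu.2, hw.1]⟩
            exact mul_le_mul hξ this (abs_nonneg _) ((abs_nonneg _).trans hξ)
          have h2 := Real.cos_le_one_sub_mul_cos_sq h1
          rw [← Real.cos_sub, ← mul_sub]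
          rw [mul_pow] at h2
          linarith
      _ = _ := by
          rw [integral_sub (integrable_const _) (hint (by fun_prop)),
            integral_add (hint (by fun_prop)) (hint (by fun_prop)), integral_const_mul,
            integral_const_mul]
          simp [← hW, ← hC, ← hD]
  have houter : 2 / Real.pi ^ 2 * ξ ^ 2 * Q ≤ W ^ 2 - (C ^ 2 + D ^ 2) := by
    calc _ = ∫ u, 2 / Real.pi ^ 2 * ξ ^ 2 * J u ∂σ := (integral_const_mul _ _).symm
      _ ≤ ∫ u, (W - (Real.cos (ξ * u) * C + Real.sin (ξ * u) * D)) ∂σ :=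
          integral_mono_ae (hint (by fun_prop)) (hint (by fun_prop)) hinner
      _ = _ := by
          rw [integral_sub (integrable_const _) (hint (by fun_prop)),
            integral_add (hint (by fun_prop)) (hint (by fun_prop)), integral_mul_const,
            integral_mul_const]
          simp [← hW, ← hC, ← hD]
          ring
  rw [← hnorm] at houter
  have h1 : W ^ 2 - ‖charFun σ ξ‖ ^ 2 ≤ (W - ‖charFun σ ξ‖) * (2 * W) := by nlinarith
  have h2 : 2 / Real.pi ^ 2 * Q / (2 * W) * ξ ^ 2 ≤ W - ‖charFun σ ξ‖ := by
    calc _ = 2 / Real.pi ^ 2 * ξ ^ 2 * Q / (2 * W) := by ring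
      _ ≤ _ := by
        rw [div_le_iff₀ (by positivity)]
        linarith
  linarith

lemma norm_charFun_le_of_le {σ ρ : Measure ℝ} [IsFiniteMeasure σ] [IsFiniteMeasure ρ]
    (h : σ ≤ ρ) (ξ : ℝ) : ‖charFun ρ ξ‖ ≤ ρ.real univ - (σ.real univ - ‖charFun σ ξ‖) := by
  obtain ⟨τ, hτ, rfl⟩ : ∃ τ : Measure ℝ, IsFiniteMeasure τ ∧ ρ = τ + σ :=
    ⟨ρ - σ, inferInstance, (Measure.sub_add_cancel_of_le h).symm⟩
  have hint : ∀ (κ : Measure ℝ) [IsFiniteMeasure κ],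
      Integrable (fun u : ℝ => Complex.exp (ξ * u * Complex.I)) κ := by
    intro κ _
    refine (integrable_const (1 : ℝ)).mono' (by fun_prop) (Eventually.of_forall fun u => ?_)
    rw [← Complex.ofReal_mul, Complex.norm_exp_ofReal_mul_I]
  have h1 : charFun (τ + σ) ξ = charFun τ ξ + charFun σ ξ := by
    simp_rw [charFun_apply_real]
    exact integral_add_measure (hint τ) (hint σ)
  have h2 := norm_add_le (charFun τ ξ) (charFun σ ξ)
  have h3 : ‖charFun τ ξ‖ ≤ τ.real univ := norm_charFun_le ξ
  rw [h1, measureReal_add_apply]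
  linarith

lemma exists_measure_Icc_ne_zero {ν : Measure ℝ} (hν : ν ≠ 0) {r : ℝ} (hr : 0 < r) :
    ∃ a, ν (Icc a (a + r)) ≠ 0 := by
  obtain ⟨x, -, hx⟩ := exists_mem_forall_mem_nhdsWithin_pos_measure (μ := ν) (s := univ)
    (by simpa using hν)
  rw [nhdsWithin_univ] at hx
  refine ⟨x - r / 2, (hx _ (Icc_mem_nhds (by linarith) (by linarith))).ne'⟩

/-- Quadratic decay of the characteristic functions of the tilted laws, uniformly in the tilting
parameter. -/
lemma exists_norm_charFun_tilted_le {ν : Measure ℝ} [IsProbabilityMeasure ν] [NullSingletonClass ν]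
    (hexp : ∀ s, Integrable (fun u => Real.exp (s * u)) ν) (S : ℝ) {R : ℝ} (hR : 0 < R) :
    ∃ c, 0 < c ∧ ∀ s, 0 ≤ s → s ≤ S → ∀ ξ, |ξ| ≤ R →
      ‖charFun (ν.tilted (s * ·)) ξ‖ ≤ 1 - c * ξ ^ 2 := by
  obtain ⟨a, ha⟩ := exists_measure_Icc_ne_zero (IsProbabilityMeasure.ne_zero ν)
    (div_pos Real.pi_pos hR)
  set b := a + Real.pi / R with hb
  set r := max |a| |b| with hr
  set c₀ : ℝ := Real.exp (-(S * r)) / (1 + ∫ u, Real.exp (S * u) ∂ν) with hc₀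
  have hS0 : 0 < ∫ u, Real.exp (S * u) ∂ν := integral_exp_pos (hexp S)
  have hc₀0 : 0 < c₀ := by positivity
  obtain ⟨c, hc, h⟩ := exists_norm_charFun_le_of_ae_mem_Icc (σ := ν.restrict (Icc a b)) (R := R)
    (by rwa [Ne, Measure.restrict_eq_zero]) (ae_restrict_mem measurableSet_Icc)
    (by rw [hb, add_sub_cancel_left, mul_div_cancel₀ _ hR.ne'])
  refine ⟨c₀ * c, by positivity, fun s hs0 hsS ξ hξ => ?_⟩
  have := isProbabilityMeasure_tilted (hexp s)
  have hM0 : 0 < ∫ u, Real.exp (s * u) ∂ν := integral_exp_pos (hexp s)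
  have hM : ∫ u, Real.exp (s * u) ∂ν ≤ 1 + ∫ u, Real.exp (S * u) ∂ν := by
    calc _ ≤ ∫ u, (1 + Real.exp (S * u)) ∂ν := by
          refine integral_mono (hexp s) ((integrable_const 1).add (hexp S)) fun u => ?_
          simp only
          rcases le_total u 0 with hu | hu
          · have : Real.exp (s * u) ≤ 1 := Real.exp_le_one_iff.2 (by nlinarith)
            linarith [Real.exp_pos (S * u)]
          · have : Real.exp (s * u) ≤ Real.exp (S * u) := Real.exp_le_exp.2 (by nlinarith)
            linarith
      _ = _ := by
          rw [integral_add (integrable_const 1) (hexp S)]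
          simp
  have hle : ENNReal.ofReal c₀ • ν.restrict (Icc a b) ≤ ν.tilted (s * ·) := by
    rw [Measure.le_iff]
    intro A hA
    rw [tilted_apply' _ _ hA, Measure.smul_apply, Measure.restrict_apply hA, smul_eq_mul,
      ← setLIntegral_const]
    refine (setLIntegral_mono' (hA.inter measurableSet_Icc) fun u hu => ?_).trans
      (lintegral_mono_set inter_subset_left)
    refine ENNReal.ofReal_le_ofReal (div_le_div₀ (Real.exp_pos _).le ?_ hM0 hM)
    refine Real.exp_le_exp.2 ?_
    have h1 : |u| ≤ r := abs_le_max_abs_abs hu.2.1 hu.2.2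
    have h2 : s * |u| ≤ S * r := mul_le_mul hsS h1 (abs_nonneg _) (hs0.trans hsS)
    have h3 : s * -|u| ≤ s * u := mul_le_mul_of_nonneg_left (neg_abs_le u) hs0
    linarith
  have := isFiniteMeasure_of_le _ hle
  have h1 := norm_charFun_le_of_le hle ξ
  have h2 : charFun (ENNReal.ofReal c₀ • ν.restrict (Icc a b)) ξ
      = c₀ * charFun (ν.restrict (Icc a b)) ξ := by
    simp_rw [charFun_apply_real]
    rw [integral_smul_measure, ENNReal.toReal_ofReal hc₀0.le]
    simp
  rw [h2, norm_mul, Complex.norm_real, Real.norm_of_nonneg hc₀0.le, measureReal_ennreal_smul_apply,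
    ENNReal.toReal_ofReal hc₀0.le, probReal_univ] at h1
  have h3 := mul_le_mul_of_nonneg_left (h ξ hξ) hc₀0.le
  linarith

lemma exists_third_moment_tilted_le {ν : Measure ℝ} [IsProbabilityMeasure ν]
    (hexp : ∀ s, Integrable (fun u => Real.exp (s * u)) ν) {S : ℝ} (hS : 0 ≤ S) (Q : ℝ) :
    ∃ B, ∀ s q, 0 ≤ s → s ≤ S → |q| ≤ Q →
      Integrable (fun u => |u - q| ^ 3) (ν.tilted (s * ·)) ∧
        ∫ u, |u - q| ^ 3 ∂(ν.tilted (s * ·)) ≤ B := by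
  set G : ℝ → ℝ := fun u => 6 * Real.exp Q * (Real.exp (-1 * u) + Real.exp ((S + 1) * u)) with hG
  have hGi : Integrable G ν := ((hexp (-1)).add (hexp (S + 1))).const_mul _
  have hwi : Integrable (fun u => Real.exp (-(S * |u|))) ν := by
    refine (integrable_const (1 : ℝ)).mono' (by fun_prop) (Eventually.of_forall fun u => ?_)
    rw [Real.norm_of_nonneg (Real.exp_pos _).le]
    exact Real.exp_le_one_iff.2 (by have := mul_nonneg hS (abs_nonneg u); linarith)
  set w := ∫ u, Real.exp (-(S * |u|)) ∂ν with hw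
  have hw0 : 0 < w := integral_exp_pos hwi
  refine ⟨(∫ u, G u ∂ν) / w, fun s q hs0 hsS hq => ?_⟩
  have hwM : w ≤ ∫ u, Real.exp (s * u) ∂ν := by
    refine integral_mono hwi (hexp s) fun u => Real.exp_le_exp.2 ?_
    have h1 : s * |u| ≤ S * |u| := mul_le_mul_of_nonneg_right hsS (abs_nonneg _)
    have h2 : s * -|u| ≤ s * u := mul_le_mul_of_nonneg_left (neg_abs_le u) hs0
    linarith
  have hpt : ∀ u, Real.exp (s * u) * |u - q| ^ 3 ≤ G u := by
    intro u
    have h1 : |u - q| ^ 3 ≤ 6 * Real.exp |u - q| := by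
      have := Real.pow_div_factorial_le_exp |u - q| (abs_nonneg _) 3
      rw [div_le_iff₀ (by positivity)] at this
      simpa [Nat.factorial, mul_comm] using this
    have h2 : Real.exp |u - q| ≤ Real.exp Q * Real.exp |u| := by
      rw [← Real.exp_add]
      exact Real.exp_le_exp.2 (by linarith [abs_sub u q])
    have h3 : Real.exp (s * u) * Real.exp |u| ≤ Real.exp (-1 * u) + Real.exp ((S + 1) * u) := by
      rw [← Real.exp_add]
      rcases le_total 0 u with hu | hu
      · have : Real.exp (s * u + |u|) ≤ Real.exp ((S + 1) * u) := by
          refine Real.exp_le_exp.2 ?_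
          rw [abs_of_nonneg hu]
          nlinarith
        linarith [Real.exp_pos (-1 * u)]
      · have : Real.exp (s * u + |u|) ≤ Real.exp (-1 * u) := by
          refine Real.exp_le_exp.2 ?_
          rw [abs_of_nonpos hu]
          nlinarith
        linarith [Real.exp_pos ((S + 1) * u)]
    calc _ ≤ Real.exp (s * u) * (6 * (Real.exp Q * Real.exp |u|)) := by
          refine mul_le_mul_of_nonneg_left (h1.trans ?_) (Real.exp_pos _).le
          linarith
      _ = 6 * Real.exp Q * (Real.exp (s * u) * Real.exp |u|) := by ring
      _ ≤ _ := mul_le_mul_of_nonneg_left h3 (by positivity)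
  have hi : Integrable (fun u => Real.exp (s * u) * |u - q| ^ 3) ν :=
    hGi.mono' (by fun_prop) (Eventually.of_forall fun u => by
      rw [Real.norm_of_nonneg (by positivity)]
      exact hpt u)
  refine ⟨(integrable_tilted_iff (hexp s) _).2 hi, ?_⟩
  rw [integral_tilted]
  simp_rw [smul_eq_mul, div_mul_eq_mul_div]
  rw [integral_div]
  exact div_le_div₀ (integral_nonneg fun u => by positivity) (integral_mono hi hGi hpt) hw0 hwM

/-- The characteristic functions of the centered tilted laws satisfy uniform decay and Gaussian
approximation bounds. -/
lemma exists_charFun_tilted_bounds {ν : Measure ℝ} [IsProbabilityMeasure ν]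
    [NullSingletonClass ν] (hexp : ∀ s, Integrable (fun u => Real.exp (s * u)) ν) {S : ℝ}
    (hS : 0 ≤ S) (Q : ℝ) :
    ∃ (v₀ V : ℝ) (c D : ℝ → ℝ), 0 < v₀ ∧ 0 < V ∧ (∀ R, 0 < R → 0 < c R ∧ 2 * c R ≤ v₀) ∧
      (∀ R, 0 < R → 0 ≤ D R) ∧ ∀ s q, 0 ≤ s → s ≤ S → |q| ≤ Q →
      ∫ u, u ∂(ν.tilted (s * ·)) = q → ∃ v, v₀ ≤ v ∧ v ≤ V ∧ ∀ R, 0 < R → ∀ ξ, |ξ| ≤ R →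
        ‖charFun ((ν.tilted (s * ·)).map (· - q)) ξ‖ ≤ Real.exp (-(c R * ξ ^ 2)) ∧
        ‖charFun ((ν.tilted (s * ·)).map (· - q)) ξ - (Real.exp (-(v * ξ ^ 2 / 2)) : ℝ)‖
          ≤ D R * |ξ| ^ 3 := by
  obtain ⟨B', hB'⟩ := exists_third_moment_tilted_le hexp hS Q
  set B := |B'| with hB
  choose! c hc0 hc using fun R (hR : 0 < R) => exists_norm_charFun_tilted_le hexp S hR
  refine ⟨2 * c 1, 1 + B, fun R => min (c R) (c 1), fun R => 4 * B + (1 + B) ^ 2 * R,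
    mul_pos two_pos (hc0 1 one_pos), by positivity, fun R hR => ⟨lt_min (hc0 R hR) (hc0 1 one_pos),
      mul_le_mul_of_nonneg_left (min_le_right _ _) two_pos.le⟩, fun R hR => by positivity,
    fun s q hs0 hsS hq hmean => ?_⟩
  have hprob := isProbabilityMeasure_tilted (hexp s)
  obtain ⟨hi, hle⟩ := hB' s q hs0 hsS hq
  set ρ := (ν.tilted (s * ·)).map (· - q) with hρ
  have hmeas : AEMeasurable (fun u : ℝ => u - q) (ν.tilted (s * ·)) := by fun_prop
  have : IsProbabilityMeasure ρ := Measure.isProbabilityMeasure_map hmeas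
  have h3 : Integrable (fun u => |u| ^ 3) ρ :=
    (integrable_map_measure (by fun_prop) hmeas).2 hi
  have hB3 : ∫ u, |u| ^ 3 ∂ρ ≤ B := by
    rw [hρ, integral_map hmeas (by fun_prop)]
    exact hle.trans (le_abs_self _)
  have hid : Integrable (fun u : ℝ => u) (ν.tilted (s * ·)) := by
    refine ((integrable_const (1 + |q|)).add hi).mono' (by fun_prop)
      (Eventually.of_forall fun u => ?_)
    rw [Real.norm_eq_abs, Pi.add_apply]
    have h1 : |u| ≤ |u - q| + |q| := by simpa using abs_add_le (u - q) q
    rcases le_total |u - q| 1 with h | h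
    · have : 0 ≤ |u - q| ^ 3 := by positivity
      linarith
    · have : |u - q| ≤ |u - q| ^ 3 := le_self_pow₀ h (by norm_num)
      linarith
  have h0 : ∫ u, u ∂ρ = 0 := by
    rw [hρ, integral_map hmeas (by fun_prop), integral_sub hid (integrable_const q), hmean]
    simp
  have hnorm : ∀ ξ, ‖charFun ρ ξ‖ = ‖charFun (ν.tilted (s * ·)) ξ‖ := by
    intro ξ
    have := charFun_map_add_const (μ := ν.tilted (s * ·)) (-q) ξ
    simp_rw [← sub_eq_add_neg] at this
    rw [hρ, this, norm_mul]
    simp [Complex.norm_exp]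
  have hdecay : ∀ R, 0 < R → ∀ ξ, |ξ| ≤ R → ‖charFun ρ ξ‖ ≤ 1 - c R * ξ ^ 2 := by
    intro R hR ξ hξ
    rw [hnorm]
    exact hc R hR s hs0 hsS ξ hξ
  refine ⟨∫ u, u ^ 2 ∂ρ, two_mul_le_variance_of_charFun_le h3 hB3 h0 (hdecay 1 one_pos),
    integral_sq_le_one_add h3 hB3, fun R hR ξ hξ =>
      ⟨?_, norm_charFun_sub_gaussian_le h3 hB3 h0 hξ⟩⟩
  have h1 : min (c R) (c 1) * ξ ^ 2 ≤ c R * ξ ^ 2 :=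
    mul_le_mul_of_nonneg_right (min_le_left _ _) (sq_nonneg _)
  have h2 := Real.add_one_le_exp (-(min (c R) (c 1) * ξ ^ 2))
  linarith [hdecay R hR ξ hξ]

lemma integrable_mul_exp_of_integrable_exp {ν : Measure ℝ}
    (hexp : ∀ s, Integrable (fun u => Real.exp (s * u)) ν) (s : ℝ) :
    Integrable (fun u => u * Real.exp (s * u)) ν := by
  refine ((hexp (s + 1)).add (hexp (s - 1))).mono' (by fun_prop)
    (Eventually.of_forall fun u => ?_)
  rw [norm_mul, Real.norm_of_nonneg (Real.exp_pos _).le, Real.norm_eq_abs, Pi.add_apply]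
  have h1 : |u| ≤ Real.exp u + Real.exp (-u) := by
    rw [abs_le]
    constructor <;> linarith [Real.add_one_le_exp u, Real.add_one_le_exp (-u), Real.exp_pos u,
      Real.exp_pos (-u)]
  calc |u| * Real.exp (s * u) ≤ (Real.exp u + Real.exp (-u)) * Real.exp (s * u) := by gcongr
    _ = _ := by
      rw [add_mul, ← Real.exp_add, ← Real.exp_add]
      congr 2 <;> ring

/-- The tilting parameter is monotone in the tilted mean. -/
lemma tilting_le_of_mean_lt {ν : Measure ℝ}
    (hexp : ∀ s, Integrable (fun u => Real.exp (s * u)) ν) {s s₀ q K : ℝ} (hqK : q ≤ K)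
    (hq : ∫ u, u * Real.exp (s * u) ∂ν = q * ∫ u, Real.exp (s * u) ∂ν)
    (hK : K * ∫ u, Real.exp (s₀ * u) ∂ν < ∫ u, u * Real.exp (s₀ * u) ∂ν) : s ≤ s₀ := by
  by_contra! hs
  have hi : ∀ s, Integrable (fun u => (u - K) * Real.exp (s * u)) ν := fun s => by
    simp_rw [sub_mul]
    exact (integrable_mul_exp_of_integrable_exp hexp s).sub ((hexp s).const_mul K)
  have hint : ∀ s, ∫ u, (u - K) * Real.exp (s * u) ∂ν
      = ∫ u, u * Real.exp (s * u) ∂ν - K * ∫ u, Real.exp (s * u) ∂ν := fun s => by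
    simp_rw [sub_mul]
    rw [integral_sub (integrable_mul_exp_of_integrable_exp hexp s) ((hexp s).const_mul K),
      integral_const_mul]
  have hM : 0 ≤ ∫ u, Real.exp (s * u) ∂ν := integral_nonneg fun u => (Real.exp_pos _).le
  have h1 : Real.exp ((s - s₀) * K) * ∫ u, (u - K) * Real.exp (s₀ * u) ∂ν
      ≤ ∫ u, (u - K) * Real.exp (s * u) ∂ν := by
    rw [← integral_const_mul]
    refine integral_mono ((hi s₀).const_mul _) (hi s) fun u => ?_
    have h2 : Real.exp (s * u) = Real.exp ((s - s₀) * u) * Real.exp (s₀ * u) := by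
      rw [← Real.exp_add]
      congr 1
      ring
    simp only
    rw [h2]
    have h3 : 0 ≤ (u - K) * (Real.exp ((s - s₀) * u) - Real.exp ((s - s₀) * K)) := by
      rcases le_total K u with h | h
      · exact mul_nonneg (by linarith) (sub_nonneg.2 (Real.exp_le_exp.2 (by nlinarith)))
      · exact mul_nonneg_of_nonpos_of_nonpos (by linarith)
          (sub_nonpos.2 (Real.exp_le_exp.2 (by nlinarith)))
    have := mul_nonneg h3 (Real.exp_pos (s₀ * u)).le
    linarith
  have h2 : 0 < Real.exp ((s - s₀) * K) * ∫ u, (u - K) * Real.exp (s₀ * u) ∂ν :=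
    mul_pos (Real.exp_pos _) (by rw [hint]; linarith)
  rw [hint s, hq] at h1
  nlinarith

/-- The tail of a measure expressed through the tail mean of its tilted and centered version. -/
lemma real_Ici_eq_mul_tailMean {P : Measure ℝ} [NeZero P] {s : ℝ}
    (hs : Integrable (fun u => Real.exp (s * u)) P) (a x : ℝ) :
    P.real (Ici (a + x)) = (∫ u, Real.exp (s * u) ∂P) * Real.exp (-(s * (a + x)))
      * tailMean s ((P.tilted (s * ·)).map (· - a)) x := by
  have hM : 0 < ∫ u, Real.exp (s * u) ∂P := integral_exp_pos hs
  have hmeas : Measurable fun t => expTail s (t - x) := (measurable_expTail s).comp (by fun_prop)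
  rw [tailMean, integral_map (by fun_prop) hmeas.aestronglyMeasurable, integral_tilted,
    ← integral_const_mul, ← integral_indicator_one measurableSet_Ici]
  refine integral_congr_ae (Eventually.of_forall fun u => ?_)
  simp only [smul_eq_mul, expTail]
  by_cases h : a + x ≤ u
  · rw [indicator_of_mem (mem_Ici.2 h), indicator_of_mem (mem_Ici.2 (by linarith)), Pi.one_apply]
    have h1 : Real.exp (-(s * (a + x))) * Real.exp (s * u) * Real.exp (-(s * (u - a - x))) = 1 := by
      rw [← Real.exp_add, ← Real.exp_add, Real.exp_eq_one_iff]
      ring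
    field_simp
    linarith
  · rw [indicator_of_notMem (by simpa using h), indicator_of_notMem (by
      rw [mem_Ici]
      intro h'
      linarith)]
    simp

lemma integral_exp_map_sum_pi (ν : Measure ℝ) [SigmaFinite ν] (n : ℕ) (s : ℝ) :
    ∫ y, Real.exp (s * y) ∂((Measure.pi fun _ : Fin n => ν).map fun ω => ∑ i, ω i)
      = (∫ u, Real.exp (s * u) ∂ν) ^ n := by
  rw [integral_map (by fun_prop) (by fun_prop)]
  simp_rw [Finset.mul_sum, Real.exp_sum]
  rw [integral_fintype_prod_eq_pow (fun u : ℝ => Real.exp (s * u)), Fintype.card_fin]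

lemma integrable_exp_map_sum_pi {ν : Measure ℝ} [SigmaFinite ν] (n : ℕ) {s : ℝ}
    (hs : Integrable (fun u => Real.exp (s * u)) ν) :
    Integrable (fun y => Real.exp (s * y))
      ((Measure.pi fun _ : Fin n => ν).map fun ω => ∑ i, ω i) := by
  rw [integrable_map_measure (by fun_prop) (by fun_prop)]
  have : (fun y => Real.exp (s * y)) ∘ (fun ω : Fin n → ℝ => ∑ i, ω i)
      = fun ω => ∏ i, Real.exp (s * ω i) := by
    ext ω
    simp [Finset.mul_sum, Real.exp_sum]
  rw [this]
  exact Integrable.fintype_prod fun _ => hs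

/-- The characteristic function of the tilted and centered law of a sum of independent copies. -/
lemma charFun_tilted_map_sum_pi (ν : Measure ℝ) [SigmaFinite ν] (n : ℕ) (s q ξ : ℝ) :
    charFun ((((Measure.pi fun _ : Fin n => ν).map fun ω => ∑ i, ω i).tilted (s * ·)).map
      (· - q * n)) ξ = charFun ((ν.tilted (s * ·)).map (· - q)) ξ ^ n := by
  rw [charFun_apply_real, charFun_apply_real, integral_map (by fun_prop) (by fun_prop),
    integral_map (by fun_prop) (by fun_prop), integral_tilted, integral_tilted,
    integral_exp_map_sum_pi, integral_map (by fun_prop) (by fun_prop)]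
  have h := integral_fintype_prod_eq_pow (ι := Fin n) (μ := ν) fun u : ℝ =>
    (Real.exp (s * u) / ∫ u, Real.exp (s * u) ∂ν) • Complex.exp (ξ * (u - q : ℝ) * Complex.I)
  rw [Fintype.card_fin] at h
  rw [← h]
  refine integral_congr_ae (Eventually.of_forall fun ω => ?_)
  simp only [Complex.real_smul]
  rw [Finset.prod_mul_distrib, ← Complex.exp_sum, ← Complex.ofReal_prod, Finset.prod_div_distrib,
    ← Real.exp_sum, Finset.prod_const, Finset.card_univ, Fintype.card_fin, ← Finset.mul_sum,
    ← Finset.sum_mul, ← Finset.mul_sum, ← Complex.ofReal_sum, Finset.sum_sub_distrib,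
    Finset.sum_const, Finset.card_univ, Fintype.card_fin, nsmul_eq_mul, mul_comm q]

lemma integral_withDensity_ofReal {g : ℝ → ℝ} (hg_meas : Measurable g) (hg : ∀ y, 0 ≤ g y)
    (f : ℝ → ℝ) :
    ∫ u, f u ∂(volume.withDensity fun t => ENNReal.ofReal (g t)) = ∫ u, f u * g u := by
  rw [integral_withDensity_eq_integral_toReal_smul (by fun_prop) (by simp)]
  refine integral_congr_ae (Eventually.of_forall fun u => ?_)
  simp only [ENNReal.toReal_ofReal (hg u), smul_eq_mul, mul_comm]

lemma integrable_withDensity_ofReal_iff {g : ℝ → ℝ} (hg_meas : Measurable g) (hg : ∀ y, 0 ≤ g y)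
    (f : ℝ → ℝ) :
    Integrable f (volume.withDensity fun t => ENNReal.ofReal (g t)) ↔
      Integrable fun u => f u * g u := by
  rw [integrable_withDensity_iff_integrable_smul' (by fun_prop) (by simp)]
  refine integrable_congr (Eventually.of_forall fun u => ?_)
  simp only [ENNReal.toReal_ofReal (hg u), smul_eq_mul, mul_comm]

lemma isProbabilityMeasure_withDensity_ofReal {g : ℝ → ℝ} (hg : ∀ y, 0 ≤ g y)
    (hi : Integrable g) (hg_prob : ∫ y, g y = 1) :
    IsProbabilityMeasure (volume.withDensity fun t => ENNReal.ofReal (g t)) := by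
  refine ⟨?_⟩
  rw [withDensity_apply _ MeasurableSet.univ, Measure.restrict_univ,
    ← ofReal_integral_eq_lintegral_ofReal hi (Eventually.of_forall hg), hg_prob,
    ENNReal.ofReal_one]

/-- Uniform local Bahadur–Rao-type estimate: for i.i.d. `u_i` with density `g` and finite
moment generating function, `m = E u₁`, `m < K < Λ'(∞)` (encoded by `Λ'(s₀) > K` for some
`s₀`), `β ∈ (0,1/2)`, and `η(q)` the tilting parameter solving
`∫ u e^{η(q)u} g(u) du = q ∫ e^{η(q)u} g(u) du` for `q ∈ [m,K]`: for every `ε > 0`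
there is `τ₀` such that for all `τ ≥ τ₀`, `q ∈ [m,K]` and `|x| ≤ τ^β`,
`|P(S_τ ≥ qτ + x)/P(S_τ ≥ qτ) - e^{-η(q)x}| ≤ ε e^{-η(q)x}`. -/
theorem bahadur_rao_uniform_ratio
    (g : ℝ → ℝ) (hg_meas : Measurable g) (hg_nonneg : ∀ y, 0 ≤ g y)
    (hg_prob : ∫ y, g y = 1)
    (hg_exp : ∀ s : ℝ, Integrable (fun u => Real.exp (s * u) * g u))
    (m K β : ℝ) (hm : m = ∫ u, u * g u) (hβ0 : 0 < β) (hβ : β < 1 / 2)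
    (hmK : m < K)
    (hKlt : ∃ s₀ : ℝ, K * (∫ u, Real.exp (s₀ * u) * g u)
        < ∫ u, u * Real.exp (s₀ * u) * g u)
    (η : ℝ → ℝ)
    (hη : ∀ q ∈ Set.Icc m K, 0 ≤ η q ∧
      (∫ u, u * Real.exp (η q * u) * g u) = q * ∫ u, Real.exp (η q * u) * g u) :
    ∀ ε : ℝ, 0 < ε → ∃ τ₀ : ℕ, ∀ τ : ℕ, τ₀ ≤ τ →
      ∀ q ∈ Set.Icc m K, ∀ x : ℝ, |x| ≤ (τ : ℝ) ^ β →
        |((sumLaw g τ) (Set.Ici (q * τ + x))).toReal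
            / ((sumLaw g τ) (Set.Ici (q * τ))).toReal
          - Real.exp (-(η q) * x)|
        ≤ ε * Real.exp (-(η q) * x) := by
  intro ε hε
  obtain ⟨s₀, hs₀⟩ := hKlt
  set ν : Measure ℝ := volume.withDensity fun t => ENNReal.ofReal (g t) with hν
  have hprob : IsProbabilityMeasure ν := isProbabilityMeasure_withDensity_ofReal hg_nonneg
    (by simpa using hg_exp 0) hg_prob
  have hexp : ∀ s, Integrable (fun u => Real.exp (s * u)) ν := fun s =>
    (integrable_withDensity_ofReal_iff hg_meas hg_nonneg _).2 (hg_exp s)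
  simp_rw [← integral_withDensity_ofReal hg_meas hg_nonneg, ← hν] at hs₀ hη
  set S := max s₀ 0 with hS
  obtain ⟨v₀, V, c, D, hv₀, hV, hc, hD, hψ⟩ :=
    exists_charFun_tilted_bounds hexp (le_max_right s₀ 0) (max |m| |K|)
  obtain ⟨n₀, hn₀⟩ := exists_tailMean_ratio hv₀ hV (le_max_right s₀ 0) hβ0.le hβ hε hc hD
  refine ⟨n₀, fun τ hτ q hq x hx => ?_⟩
  obtain ⟨hs0, hmean⟩ := hη q hq
  set s := η q with hs
  have hsS : s ≤ S := (tilting_le_of_mean_lt hexp hq.2 hmean hs₀).trans (le_max_left _ _)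
  have hM : 0 < ∫ u, Real.exp (s * u) ∂ν := integral_exp_pos (hexp s)
  have htilt : ∫ u, u ∂(ν.tilted (s * ·)) = q := by
    rw [integral_tilted]
    simp_rw [smul_eq_mul, div_mul_eq_mul_div, mul_comm (Real.exp _)]
    rw [integral_div, hmean, mul_div_cancel_right₀ _ hM.ne']
  obtain ⟨v, hv1, hv2, hbounds⟩ := hψ s q hs0 hsS (abs_le_max_abs_abs hq.1 hq.2) htilt
  have hPexp : Integrable (fun y => Real.exp (s * y)) (sumLaw g τ) :=
    integrable_exp_map_sum_pi τ (hexp s)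
  have hPprob : IsProbabilityMeasure (sumLaw g τ) :=
    Measure.isProbabilityMeasure_map (by fun_prop)
  have := isProbabilityMeasure_tilted hPexp
  have : IsProbabilityMeasure (((sumLaw g τ).tilted (s * ·)).map (· - q * τ)) :=
    Measure.isProbabilityMeasure_map (by fun_prop)
  obtain ⟨hA0, hA⟩ := hn₀ τ hτ (((sumLaw g τ).tilted (s * ·)).map (· - q * τ))
    (charFun ((ν.tilted (s * ·)).map (· - q))) v s hv1 hv2 hs0 hsS
    (charFun_tilted_map_sum_pi ν τ s q) hbounds x hx
  set A := tailMean s (((sumLaw g τ).tilted (s * ·)).map (· - q * τ)) with hAdef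
  have hx1 := real_Ici_eq_mul_tailMean hPexp (q * τ) x
  have hx0 := real_Ici_eq_mul_tailMean hPexp (q * τ) 0
  rw [← hAdef] at hx1
  rw [add_zero, ← hAdef] at hx0
  have hN : 0 < ∫ u, Real.exp (s * u) ∂(sumLaw g τ) := integral_exp_pos hPexp
  have hsplit : Real.exp (-(s * (q * τ + x)))
      = Real.exp (-(s * (q * τ))) * Real.exp (-s * x) := by
    rw [← Real.exp_add]
    congr 1
    ring
  have hratio : (sumLaw g τ (Ici (q * τ + x))).toReal / (sumLaw g τ (Ici (q * τ))).toReal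
      = Real.exp (-s * x) * (A x / A 0) := by
    rw [← measureReal_def, ← measureReal_def, hx1, hx0, hsplit]
    have := (Real.exp_pos (-(s * (q * τ)))).ne'
    field_simp
  calc _ = Real.exp (-s * x) * |A x / A 0 - 1| := by
        rw [hratio, ← abs_of_pos (Real.exp_pos (-s * x)), ← abs_mul,
          abs_of_pos (Real.exp_pos (-s * x))]
        ring_nf
    _ ≤ Real.exp (-s * x) * ε := mul_le_mul_of_nonneg_left hA (Real.exp_pos _).le
    _ = _ := mul_comm _ _
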